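/- Let P ⊂ ℝ^d be a full-dimensional rational polytope with denominator q, write h*_P(z) = Σ_{i=0}^{q(d+1)−1} h*_i z^i (with h*_i = 0 for i > s := deg h*_P). Then h*_0 + ⋯ + h*_{j+1} ≥ h*_{q(d+1)−1} + h*_{q(d+1)−2} + ⋯ + h*_{q(d+1)−1−j} for all j = 0, …, ⌊(q(d+1)−1)/2⌋ − 1, and h*_s + h*_{s−1} + ⋯ + h*_{s−j} ≥ h*_0 + h*_1 + ⋯ + h*_j for all j = 0, …, s. -/

import Mathlib

open Pointwise

/-- `x ∈ ℤ^d`, i.e. every coordinate of `x` is an integer. -/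
def IsLatticePt {d : ℕ} (x : Fin d → ℝ) : Prop := ∀ i, ∃ a : ℤ, x i = (a : ℝ)

/-- `x ∈ ℚ^d`, i.e. every coordinate of `x` is rational. -/
def IsRationalPt {d : ℕ} (x : Fin d → ℝ) : Prop := ∀ i, ∃ a : ℚ, x i = (a : ℝ)

/-- `P` is a lattice polytope: the convex hull of finitely many points of `ℤ^d`. -/
def IsLatticePolytope {d : ℕ} (P : Set (Fin d → ℝ)) : Prop :=
  ∃ V : Finset (Fin d → ℝ), (∀ v ∈ V, IsLatticePt v) ∧ P = convexHull ℝ (V : Set (Fin d → ℝ))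

/-- `P` is a rational polytope: the convex hull of finitely many points of `ℚ^d`. -/
def IsRationalPolytope {d : ℕ} (P : Set (Fin d → ℝ)) : Prop :=
  ∃ V : Finset (Fin d → ℝ), (∀ v ∈ V, IsRationalPt v) ∧ P = convexHull ℝ (V : Set (Fin d → ℝ))

/-- A convex subset of `ℝ^d` is full-dimensional iff its interior is nonempty. -/
def IsFullDim {d : ℕ} (P : Set (Fin d → ℝ)) : Prop := (interior P).Nonempty

/-- The number of lattice points in `S`. -/
noncomputable def latCount {d : ℕ} (S : Set (Fin d → ℝ)) : ℕ :=
  Set.ncard {x ∈ S | IsLatticePt x}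

/-- The Ehrhart series `Ehr_P(z) = 1 + ∑_{n ≥ 1} #(nP ∩ ℤ^d) zⁿ`. -/
noncomputable def ehrSeries {d : ℕ} (P : Set (Fin d → ℝ)) : PowerSeries ℤ :=
  PowerSeries.mk fun n => if n = 0 then 1 else (latCount ((n : ℝ) • P) : ℤ)

/-- The interior Ehrhart series `∑_{n ≥ 1} #(nP° ∩ ℤ^d) zⁿ`. -/
noncomputable def ehrIntSeries {d : ℕ} (P : Set (Fin d → ℝ)) : PowerSeries ℤ :=
  PowerSeries.mk fun n => if n = 0 then 0 else (latCount (interior ((n : ℝ) • P)) : ℤ)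

/-- The boundary Ehrhart series `1 + ∑_{n ≥ 1} #(n ∂P ∩ ℤ^d) zⁿ`. -/
noncomputable def ehrBdSeries {d : ℕ} (P : Set (Fin d → ℝ)) : PowerSeries ℤ :=
  PowerSeries.mk fun n => if n = 0 then 1 else (latCount (frontier ((n : ℝ) • P)) : ℤ)

/-- `q` is the denominator of `P`: the smallest positive integer such that `qP` is a
lattice polytope. -/
def IsDenominator {d : ℕ} (P : Set (Fin d → ℝ)) (q : ℕ) : Prop :=
  0 < q ∧ IsLatticePolytope ((q : ℝ) • P) ∧
    ∀ k : ℕ, 0 < k → IsLatticePolytope ((k : ℝ) • P) → q ≤ k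

/-- `l` is the smallest positive integer such that the interior of `lP` contains a
lattice point. -/
def IsMinInteriorDilate {d : ℕ} (P : Set (Fin d → ℝ)) (l : ℕ) : Prop :=
  0 < l ∧ (∃ x, IsLatticePt x ∧ x ∈ interior ((l : ℝ) • P)) ∧
    ∀ k : ℕ, 0 < k → (∃ x, IsLatticePt x ∧ x ∈ interior ((k : ℝ) • P)) → l ≤ k

/-- The homogenization of the half-open simplex with vertices `w 0, …, w (k-1)`
where the facets opposite the first `r` vertices are removed:
`hom(Δ) = Σ_{j<r} ℝ_{>0} (w j, 1) + Σ_{j≥r} ℝ_{≥0} (w j, 1) ⊆ ℝ^{d+1}`. -/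
def homog {d k : ℕ} (w : Fin k → (Fin d → ℝ)) (r : ℕ) : Set (Fin (d + 1) → ℝ) :=
  {y | ∃ c : Fin k → ℝ, (∀ j : Fin k, (j : ℕ) < r → 0 < c j) ∧
    (∀ j : Fin k, r ≤ (j : ℕ) → 0 ≤ c j) ∧
    y = ∑ j : Fin k, c j • (Fin.snoc (w j) 1 : Fin (d + 1) → ℝ)}

/-- The fundamental parallelepiped
`F'_Δ = Σ_{j<r} (0,1] (q_j w_j, q_j) + Σ_{j≥r} [0,1) (q_j w_j, q_j) ⊆ ℝ^{d+1}`. -/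
def fpar {d k : ℕ} (w : Fin k → (Fin d → ℝ)) (r : ℕ) (q : Fin k → ℕ) :
    Set (Fin (d + 1) → ℝ) :=
  {y | ∃ c : Fin k → ℝ, (∀ j : Fin k, (j : ℕ) < r → c j ∈ Set.Ioc (0 : ℝ) 1) ∧
    (∀ j : Fin k, r ≤ (j : ℕ) → c j ∈ Set.Ico (0 : ℝ) 1) ∧
    y = ∑ j : Fin k, c j • ((q j : ℝ) • (Fin.snoc (w j) 1 : Fin (d + 1) → ℝ))}

/-- The generating function `∑_{x ∈ S ∩ ℤ^{d+1}} z^{x_{d+1}}` of a subset `S ⊆ ℝ^{d+1}`,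
graded by the last coordinate. -/
noncomputable def sliceSeries {d : ℕ} (S : Set (Fin (d + 1) → ℝ)) : PowerSeries ℤ :=
  PowerSeries.mk fun n =>
    (Set.ncard {y ∈ S | IsLatticePt y ∧ y (Fin.last d) = (n : ℝ)} : ℤ)

/-- A polynomial is palindromic if `z^{deg f} f(1/z) = f(z)`,
i.e. `f_i = f_{deg f − i}` for all `i ≤ deg f`. -/
def IsPalin (f : Polynomial ℤ) : Prop :=
  ∀ i ≤ f.natDegree, f.coeff i = f.coeff (f.natDegree - i)

/-- `P` is rational reflexive: the origin is an interior point and `P = {x : A x ≤ 𝟙}`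
for some integer matrix `A`. -/
def IsRationalReflexive {d : ℕ} (P : Set (Fin d → ℝ)) : Prop :=
  IsRationalPolytope P ∧ (0 : Fin d → ℝ) ∈ interior P ∧
    ∃ (m : ℕ) (A : Fin m → Fin d → ℤ),
      P = {x : Fin d → ℝ | ∀ j, (∑ i, (A j i : ℝ) * x i) ≤ 1}

/-- `P` is a reflexive (lattice) polytope. -/
def IsReflexive {d : ℕ} (P : Set (Fin d → ℝ)) : Prop :=
  IsLatticePolytope P ∧ (0 : Fin d → ℝ) ∈ interior P ∧
    ∃ (m : ℕ) (A : Fin m → Fin d → ℤ),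
      P = {x : Fin d → ℝ | ∀ j, (∑ i, (A j i : ℝ) * x i) ≤ 1}

/-- `P` is an integral translate of a reflexive polytope. -/
def IsTranslatedReflexive {d : ℕ} (P : Set (Fin d → ℝ)) : Prop :=
  ∃ (Q : Set (Fin d → ℝ)) (t : Fin d → ℤ), IsReflexive Q ∧
    P = (fun y => y + fun i => (t i : ℝ)) '' Q

/-- The rational Ehrhart series `1 + ∑_{n ≥ 1} #((n/r) P ∩ ℤ^d) wⁿ`. -/
noncomputable def ratEhrSeries {d : ℕ} (P : Set (Fin d → ℝ)) (r : ℕ) : PowerSeries ℤ :=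
  PowerSeries.mk fun n => if n = 0 then 1 else (latCount (((n : ℝ) / (r : ℝ)) • P) : ℤ)

/-- The rational boundary Ehrhart series `1 + ∑_{n ≥ 1} #((n/r) ∂P ∩ ℤ^d) wⁿ`. -/
noncomputable def ratEhrBdSeries {d : ℕ} (P : Set (Fin d → ℝ)) (r : ℕ) : PowerSeries ℤ :=
  PowerSeries.mk fun n =>
    if n = 0 then 1 else (latCount (frontier (((n : ℝ) / (r : ℝ)) • P)) : ℤ)

/-- `r` is the codenominator of `P`: given an irredundant halfspace description
`P = {x : A x ≤ b}` with integer data and `gcd(b_j, A_{j,1}, …, A_{j,d}) = 1` for each `j`,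
`r` is the least common multiple of the nonzero entries of `b`. -/
def IsCodenominator {d : ℕ} (P : Set (Fin d → ℝ)) (r : ℕ) : Prop :=
  ∃ (m : ℕ) (A : Fin m → Fin d → ℤ) (b : Fin m → ℤ),
    P = {x : Fin d → ℝ | ∀ j, (∑ i, (A j i : ℝ) * x i) ≤ (b j : ℝ)} ∧
    (∀ j₀ : Fin m,
      P ≠ {x : Fin d → ℝ | ∀ j, j ≠ j₀ → (∑ i, (A j i : ℝ) * x i) ≤ (b j : ℝ)}) ∧
    (∀ j, Int.gcd (b j) (Finset.univ.gcd fun i => A j i) = 1) ∧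
    (r : ℤ) = (Finset.univ.filter fun j => b j ≠ 0).lcm b


lemma ps_partial_nonneg (D : PowerSeries ℤ) (hD : ∀ n, 0 ≤ PowerSeries.coeff n D) (q K : ℕ) :
    0 ≤ ∑ k ∈ Finset.range K, PowerSeries.coeff k ((1 - PowerSeries.X ^ q) * D) := by
  have h1 : ∀ k, PowerSeries.coeff k ((1 - PowerSeries.X ^ q) * D)
      = PowerSeries.coeff k D - (if q ≤ k then PowerSeries.coeff (k - q) D else 0) := by
    intro k
    rw [sub_mul, one_mul, map_sub, PowerSeries.coeff_X_pow_mul']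
  simp_rw [h1]
  rw [Finset.sum_sub_distrib, sub_nonneg, ← Finset.sum_filter]
  rw [← Finset.sum_image (f := fun k => PowerSeries.coeff k D) (g := fun k => k - q)]
  · apply Finset.sum_le_sum_of_subset_of_nonneg
    · intro k hk
      simp only [Finset.mem_image, Finset.mem_filter, Finset.mem_range] at hk ⊢
      omega
    · intro k _ _; exact hD k
  · intro a ha b hb hab
    simp only [Finset.coe_filter, Finset.mem_range, Set.mem_ofPred_eq] at ha hb hab
    omega

lemma ps_reciprocity (h : Polynomial ℤ) (q d l : ℕ) (hl : 0 < l)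
    (hdeg : h.natDegree < q * (d + 1)) (G G' A A' : PowerSeries ℤ)
    (hG : (h : PowerSeries ℤ) = (1 - PowerSeries.X ^ q) ^ (d + 1) * G)
    (hA : (1 - PowerSeries.X ^ l) * (1 - PowerSeries.X ^ q) ^ d * G = A)
    (hA' : (1 - PowerSeries.X ^ l) * (1 - PowerSeries.X ^ q) ^ d * G' = A')
    (hz : ∀ k, l + q * d < k → PowerSeries.coeff k A = 0)
    (hz' : ∀ k, l + q * d < k → PowerSeries.coeff k A' = 0)
    (hr : ∀ k, k ≤ l + q * d → PowerSeries.coeff k A' = PowerSeries.coeff (l + q * d - k) A) :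
    ((Polynomial.reflect (q * (d + 1)) h : Polynomial ℤ) : PowerSeries ℤ)
      = (1 - PowerSeries.X ^ q) ^ (d + 1) * G' := by
  set M := l + q * d with hM
  have hAp : ((PowerSeries.trunc (M + 1) A : Polynomial ℤ) : PowerSeries ℤ) = A := by
    ext k
    rw [Polynomial.coeff_coe, PowerSeries.coeff_trunc]
    split_ifs with hk
    · rfl
    · rw [hz k (by omega)]
  set Ap := PowerSeries.trunc (M + 1) A with hApd
  have hApdeg : Ap.natDegree ≤ M := by
    have := PowerSeries.natDegree_trunc_lt A M
    rw [← hApd] at this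
    omega
  have hAp' : ((Polynomial.reflect M Ap : Polynomial ℤ) : PowerSeries ℤ) = A' := by
    ext k
    rw [Polynomial.coeff_coe, Polynomial.coeff_reflect]
    by_cases hk : k ≤ M
    · rw [Polynomial.revAt_le hk, hr k hk, ← hAp, Polynomial.coeff_coe]
    · rw [hz' k (by omega), Polynomial.revAt_eq_self_of_lt (by omega)]
      exact Polynomial.coeff_eq_zero_of_natDegree_lt (by omega)
  have e1 : (1 - Polynomial.X ^ l) * h = (1 - Polynomial.X ^ q) * Ap := by
    apply Polynomial.coe_injective
    push_cast
    rw [hAp, hG, ← hA]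
    ring
  have refl1 : ∀ n : ℕ, Polynomial.reflect n (1 - Polynomial.X ^ n : Polynomial ℤ)
      = Polynomial.X ^ n - 1 := by
    intro n
    rw [Polynomial.reflect_sub, ← Polynomial.C_1, Polynomial.reflect_C]
    rw [← one_mul ((Polynomial.X : Polynomial ℤ) ^ n), ← Polynomial.C_1, Polynomial.reflect_C_mul_X_pow]
    simp
  have deg1 : ∀ n : ℕ, (1 - Polynomial.X ^ n : Polynomial ℤ).natDegree ≤ n := by
    intro n
    compute_degree
  have e2 := congrArg (Polynomial.reflect (l + q * (d + 1))) e1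
  rw [Polynomial.reflect_mul _ _ (deg1 l) hdeg.le] at e2
  rw [show l + q * (d + 1) = q + M by rw [hM]; ring, Polynomial.reflect_mul _ _ (deg1 q) hApdeg,
    refl1, refl1] at e2
  have e3 := congrArg (fun f : Polynomial ℤ => (f : PowerSeries ℤ)) e2
  push_cast at e3
  rw [hAp', ← hA'] at e3
  have hne : (PowerSeries.X ^ l - 1 : PowerSeries ℤ) ≠ 0 := by
    intro h0
    have := congrArg (PowerSeries.coeff 0) h0
    simp [hl.ne'] at this
  apply mul_left_cancel₀ hne
  rw [e3]
  ring

lemma final_ineq (h : Polynomial ℤ) (q d l : ℕ) (hl : 0 < l)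
    (hdeg : h.natDegree < q * (d + 1)) (G G' : PowerSeries ℤ)
    (hG : (h : PowerSeries ℤ) = (1 - PowerSeries.X ^ q) ^ (d + 1) * G)
    (hR : ((Polynomial.reflect (q * (d + 1)) h : Polynomial ℤ) : PowerSeries ℤ)
      = (1 - PowerSeries.X ^ q) ^ (d + 1) * G')
    (hq : 0 < q)
    (F1 : ∀ n, 0 ≤ PowerSeries.coeff n ((1 - PowerSeries.X ^ q) ^ d * (G - G')))
    (F2 : ∀ n, 0 ≤ PowerSeries.coeff n ((1 - PowerSeries.X ^ q) ^ d * (G' - PowerSeries.X ^ l * G)))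
    (G0 : PowerSeries.coeff 0 G = 1)
    (F4 : ∀ k < l, PowerSeries.coeff k G' = 0) (F5 : PowerSeries.coeff l G' ≠ 0) :
    (∀ j : ℕ, j ≤ (q * (d + 1) - 1) / 2 - 1 →
      ∑ i ∈ Finset.range (j + 1), h.coeff (q * (d + 1) - 1 - i) ≤
        ∑ i ∈ Finset.range (j + 2), h.coeff i) ∧
    (∀ j : ℕ, j ≤ h.natDegree →
      ∑ i ∈ Finset.range (j + 1), h.coeff i ≤
        ∑ i ∈ Finset.range (j + 1), h.coeff (h.natDegree - i)) := by
  set N := q * (d + 1) with hN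
  have hNpos : 0 < N := by positivity
  have hRc : ∀ k ≤ N, PowerSeries.coeff k ((1 - PowerSeries.X ^ q) ^ (d + 1) * G') = h.coeff (N - k) := by
    intro k hk
    rw [← hR, Polynomial.coeff_coe, Polynomial.coeff_reflect, Polynomial.revAt_le hk]
  have hhc : ∀ k, PowerSeries.coeff k ((1 - PowerSeries.X ^ q) ^ (d + 1) * G) = h.coeff k := by
    intro k; rw [← hG, Polynomial.coeff_coe]
  constructor
  · intro j hj
    have key := ps_partial_nonneg _ F1 q (j + 2)
    rw [show (1 - PowerSeries.X ^ q) * ((1 - PowerSeries.X ^ q) ^ d * (G - G'))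
      = (1 - PowerSeries.X ^ q) ^ (d + 1) * G - (1 - PowerSeries.X ^ q) ^ (d + 1) * G' by ring] at key
    simp_rw [map_sub, hhc] at key
    rw [Finset.sum_sub_distrib] at key
    have : ∑ k ∈ Finset.range (j + 2), PowerSeries.coeff k ((1 - PowerSeries.X ^ q) ^ (d + 1) * G')
        = ∑ i ∈ Finset.range (j + 1), h.coeff (N - 1 - i) := by
      rw [Finset.sum_range_succ', hRc 0 (by omega), Polynomial.coeff_eq_zero_of_natDegree_lt (n := N - 0) (by omega), add_zero]
      apply Finset.sum_congr rfl
      intro i hi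
      have := Finset.mem_range.1 hi
      rw [hRc (i + 1) (by omega)]
      congr 1; omega
    linarith
  · obtain ⟨U, hU⟩ : ∃ U, G' = PowerSeries.X ^ l * U := PowerSeries.X_pow_dvd_iff.2 F4
    have hlow : ∀ k < l, PowerSeries.coeff k ((1 - PowerSeries.X ^ q) ^ (d + 1) * G') = 0 := by
      apply PowerSeries.X_pow_dvd_iff.1
      rw [hU]; exact ⟨(1 - PowerSeries.X ^ q) ^ (d + 1) * U, by ring⟩
    have hUc : PowerSeries.coeff 0 U ≠ 0 := by
      have : PowerSeries.coeff (0 + l) G' = PowerSeries.coeff 0 U := by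
        rw [hU, PowerSeries.coeff_X_pow_mul]
      rw [← this, zero_add]; exact F5
    have hl' : PowerSeries.coeff l ((1 - PowerSeries.X ^ q) ^ (d + 1) * G') ≠ 0 := by
      have : PowerSeries.coeff (0 + l) ((1 - PowerSeries.X ^ q) ^ (d + 1) * G') = PowerSeries.coeff 0 U := by
        rw [hU, show (1 - PowerSeries.X ^ q) ^ (d + 1) * (PowerSeries.X ^ l * U) = PowerSeries.X ^ l * ((1 - PowerSeries.X ^ q) ^ (d + 1) * U) by ring, PowerSeries.coeff_X_pow_mul]
        simp [hq.ne']
      rw [zero_add] at this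
      rwa [this]
    have h0 : h.coeff 0 = 1 := by
      rw [← hhc 0, ← G0]
      simp [hq.ne']
    have hlN : l ≤ N := by
      by_contra hc
      have := hlow N (by omega)
      rw [hRc N le_rfl, Nat.sub_self, h0] at this
      exact one_ne_zero this
    have hs : h.natDegree = N - l := by
      apply le_antisymm
      · rw [Polynomial.natDegree_le_iff_coeff_eq_zero]
        intro k hk
        by_cases hkN : k ≤ N
        · have := hlow (N - k) (by omega)
          rw [hRc _ (by omega)] at this
          rwa [Nat.sub_sub_self hkN] at this
        · exact Polynomial.coeff_eq_zero_of_natDegree_lt (by omega)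
      · apply Polynomial.le_natDegree_of_ne_zero
        rw [← hRc l hlN]; exact hl'
    intro j hj
    rw [hs] at hj ⊢
    have key := ps_partial_nonneg _ F2 q (l + (j + 1))
    rw [show (1 - PowerSeries.X ^ q) * ((1 - PowerSeries.X ^ q) ^ d * (G' - PowerSeries.X ^ l * G))
      = (1 - PowerSeries.X ^ q) ^ (d + 1) * G' - PowerSeries.X ^ l * ((1 - PowerSeries.X ^ q) ^ (d + 1) * G) by ring] at key
    rw [Finset.sum_range_add] at key
    rw [Finset.sum_eq_zero (s := Finset.range l), zero_add] at key
    · simp_rw [map_sub] at key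
      rw [Finset.sum_sub_distrib] at key
      have e1 : ∑ x ∈ Finset.range (j + 1), PowerSeries.coeff (l + x) ((1 - PowerSeries.X ^ q) ^ (d + 1) * G')
          = ∑ i ∈ Finset.range (j + 1), h.coeff (N - l - i) := by
        apply Finset.sum_congr rfl
        intro i hi
        have := Finset.mem_range.1 hi
        rw [hRc (l + i) (by omega)]
        congr 1; omega
      have e2 : ∑ x ∈ Finset.range (j + 1), PowerSeries.coeff (l + x) (PowerSeries.X ^ l * ((1 - PowerSeries.X ^ q) ^ (d + 1) * G))
          = ∑ i ∈ Finset.range (j + 1), h.coeff i := by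
        apply Finset.sum_congr rfl
        intro i hi
        rw [add_comm l i, PowerSeries.coeff_X_pow_mul, hhc]
      rw [e1, e2] at key
      linarith
    · intro k hk
      have := Finset.mem_range.1 hk
      rw [map_sub, hlow k this, PowerSeries.coeff_X_pow_mul', if_neg (by omega), sub_zero]


section Counting
variable {E : Type*} [AddCommGroup E] [Module ℝ E]

/-- graded generating function of lattice points of a set -/
noncomputable def gfs (L : AddSubgroup E) (dg : E →ₗ[ℝ] ℝ) (S : Set E) : PowerSeries ℤ :=
  PowerSeries.mk fun n => (Set.ncard {y | y ∈ S ∧ y ∈ L ∧ dg y = (n : ℝ)} : ℤ)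

lemma gfs_nonneg (L : AddSubgroup E) (dg : E →ₗ[ℝ] ℝ) (S : Set E) (n : ℕ) :
    0 ≤ PowerSeries.coeff n (gfs L dg S) := by
  simp [gfs]

/-- slices are finite -/
def FinSl (L : AddSubgroup E) (dg : E →ₗ[ℝ] ℝ) (S : Set E) : Prop :=
  ∀ n : ℕ, {y | y ∈ S ∧ y ∈ L ∧ dg y = (n : ℝ)}.Finite

lemma FinSl.mono {L : AddSubgroup E} {dg : E →ₗ[ℝ] ℝ} {S T : Set E} (h : FinSl L dg T)
    (hST : S ⊆ T) : FinSl L dg S := fun n =>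
  (h n).subset fun _ hy => ⟨hST hy.1, hy.2⟩

lemma gfs_union {L : AddSubgroup E} {dg : E →ₗ[ℝ] ℝ} {S T : Set E} (hS : FinSl L dg S)
    (hT : FinSl L dg T) (hd : Disjoint S T) : gfs L dg (S ∪ T) = gfs L dg S + gfs L dg T := by
  ext n
  simp only [gfs, PowerSeries.coeff_mk, map_add]
  rw [← Nat.cast_add, ← Set.ncard_union_eq _ (hS n) (hT n)]
  · congr 2
    ext y; simp only [Set.mem_union, Set.mem_ofPred_eq]; tauto
  · rw [Set.disjoint_left] at hd ⊢
    intro y hy hy'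
    exact hd hy.1 hy'.1

lemma gfs_biUnion {L : AddSubgroup E} {dg : E →ₗ[ℝ] ℝ} {κ : Type*} (T : Finset κ)
    (S : κ → Set E) (hS : ∀ k ∈ T, FinSl L dg (S k))
    (hd : ∀ k ∈ T, ∀ k' ∈ T, k ≠ k' → Disjoint (S k) (S k')) :
    gfs L dg (⋃ k ∈ T, S k) = ∑ k ∈ T, gfs L dg (S k) := by
  classical
  suffices h : gfs L dg (⋃ k ∈ T, S k) = ∑ k ∈ T, gfs L dg (S k) ∧ FinSl L dg (⋃ k ∈ T, S k) from h.1
  induction T using Finset.induction_on with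
  | empty =>
    constructor
    · ext n; simp [gfs]
    · intro n; simp
  | insert a T ha ih =>
    have ih' := ih (fun k hk => hS k (Finset.mem_insert_of_mem hk))
      (fun k hk k' hk' => hd k (Finset.mem_insert_of_mem hk) k' (Finset.mem_insert_of_mem hk'))
    rw [Finset.set_biUnion_insert, Finset.sum_insert ha]
    constructor
    · rw [gfs_union (hS a (Finset.mem_insert_self _ _)) ih'.2, ih'.1]
      simp only [Set.disjoint_iUnion_right]
      intro k hk
      exact hd a (Finset.mem_insert_self _ _) k (Finset.mem_insert_of_mem hk) (by rintro rfl; exact ha hk)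
    · intro n
      refine ((hS a (Finset.mem_insert_self _ _) n).union (ih'.2 n)).subset ?_
      rintro y ⟨hy | hy, hy'⟩
      · exact Or.inl ⟨hy, hy'⟩
      · exact Or.inr ⟨hy, hy'⟩

lemma gfs_shift {L : AddSubgroup E} {dg : E →ₗ[ℝ] ℝ} {S : Set E} {g : E} {e : ℕ}
    (hg : g ∈ L) (he : dg g = e) (hpos : ∀ y ∈ S, 0 ≤ dg y) :
    gfs L dg {y | y - g ∈ S} = PowerSeries.X ^ e * gfs L dg S := by
  ext n
  rw [PowerSeries.coeff_X_pow_mul']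
  simp only [gfs, PowerSeries.coeff_mk]
  split_ifs with h
  · congr 1
    apply Set.ncard_congr (fun y _ => y - g)
    · rintro y ⟨h1, h2, h3⟩
      refine ⟨h1, L.sub_mem h2 hg, ?_⟩
      rw [map_sub, h3, he, Nat.cast_sub h]
    · intro a b _ _ hab
      exact sub_left_injective hab
    · rintro y ⟨h1, h2, h3⟩
      refine ⟨y + g, ⟨by simpa using h1, L.add_mem h2 hg, ?_⟩, by simp⟩
      rw [map_add, h3, he, Nat.cast_sub h]; ring
  · rw [Nat.cast_eq_zero]
    refine (congrArg Set.ncard ?_).trans (Set.ncard_empty E)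
    rw [Set.eq_empty_iff_forall_notMem]
    rintro y ⟨h1, h2, h3⟩
    have := hpos _ h1
    rw [map_sub, h3, he] at this
    have : (e : ℝ) ≤ n := by linarith
    exact h (by exact_mod_cast this)

lemma gfs_peel {L : AddSubgroup E} {dg : E →ₗ[ℝ] ℝ} {S : Set E} {g : E} {e : ℕ}
    (hS : FinSl L dg S) (hg : g ∈ L) (he : dg g = e) (hpos : ∀ y ∈ S, 0 ≤ dg y)
    (hsub : ∀ y, y - g ∈ S → y ∈ S) :
    (1 - PowerSeries.X ^ e) * gfs L dg S = gfs L dg {y | y ∈ S ∧ y - g ∉ S} := by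
  have h1 : S = {y | y ∈ S ∧ y - g ∉ S} ∪ {y | y - g ∈ S} := by
    ext y; simp only [Set.mem_union, Set.mem_ofPred_eq]
    have := hsub y
    tauto
  have h2 : gfs L dg S = gfs L dg {y | y ∈ S ∧ y - g ∉ S} + gfs L dg {y | y - g ∈ S} := by
    conv_lhs => rw [h1]
    apply gfs_union
    · exact hS.mono fun y hy => hy.1
    · exact hS.mono fun y hy => hsub y hy
    · rw [Set.disjoint_left]
      rintro y ⟨_, hy⟩ hy'; exact hy hy'
  rw [gfs_shift hg he hpos] at h2
  rw [sub_mul, one_mul]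
  nth_rewrite 1 [h2]
  ring

/-- perturbed positivity of `a` with infinitesimal part `b` -/
def lpos (a b : ℝ) : Prop := 0 < a ∨ (a = 0 ∧ 0 < b)

lemma lpos_neg {a b : ℝ} (hb : b ≠ 0) : lpos (-a) (-b) ↔ ¬ lpos a b := by
  unfold lpos
  rcases lt_trichotomy a 0 with h | h | h <;> rcases lt_or_gt_of_ne hb with h' | h' <;>
    constructor <;> intro H <;> grind

variable {ι : Type*} [DecidableEq ι]

/-- Frame: `p` and `w i`, `i ∈ B`, form a basis with coordinates `φ`, `c`. -/
structure Fr (p : E) (w : ι → E) (B : Finset ι) (φ : E →ₗ[ℝ] ℝ) (c : ι → E →ₗ[ℝ] ℝ) : Prop where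
  expand : ∀ y, y = φ y • p + ∑ i ∈ B, c i y • w i
  φp : φ p = 1
  φw : ∀ i ∈ B, φ (w i) = 0
  cp : ∀ i ∈ B, c i p = 0
  cw : ∀ i ∈ B, ∀ j ∈ B, c i (w j) = if i = j then 1 else 0
  card : B.card + 1 = Module.finrank ℝ E

/-- Half-open cone piece. -/
def Sb (B : Finset ι) (φ : E →ₗ[ℝ] ℝ) (c : ι → E →ₗ[ℝ] ℝ) (ξ : E) (T : Set ℝ) : Set E :=
  {y | φ y ∈ T ∧ ∀ i ∈ B, lpos (c i y) (c i ξ)}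

/-- Half-open box piece. -/
def Bx (B : Finset ι) (φ : E →ₗ[ℝ] ℝ) (c : ι → E →ₗ[ℝ] ℝ) (ξ : E) (T : Set ℝ) (J : Finset ι) : Set E :=
  {y | y ∈ Sb B φ c ξ T ∧ ∀ i ∈ J, ¬ lpos (c i y - 1) (c i ξ)}

lemma lpos_of_sub_one {a b : ℝ} (h : lpos (a - 1) b) : lpos a b := by
  unfold lpos at *; left; rcases h with h | h <;> linarith [h]

lemma gfs_Sb {L : AddSubgroup E} {dg : E →ₗ[ℝ] ℝ} {p : E} {w : ι → E} {B : Finset ι}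
    {φ : E →ₗ[ℝ] ℝ} {c : ι → E →ₗ[ℝ] ℝ} (hF : Fr p w B φ c) {ξ : E} {T : Set ℝ} {q : ℕ}
    (hw : ∀ i, w i ∈ L) (hq : ∀ i, dg (w i) = q)
    (hS : FinSl L dg (Sb B φ c ξ T)) (hpos : ∀ y ∈ Sb B φ c ξ T, 0 ≤ dg y)
    (J : Finset ι) (hJ : J ⊆ B) :
    (1 - PowerSeries.X ^ q) ^ J.card * gfs L dg (Sb B φ c ξ T) = gfs L dg (Bx B φ c ξ T J) := by
  induction J using Finset.induction_on with
  | empty => simp [Bx]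
  | insert a J ha ih =>
    have haB : a ∈ B := hJ (Finset.mem_insert_self _ _)
    have hJB : J ⊆ B := fun x hx => hJ (Finset.mem_insert_of_mem hx)
    rw [Finset.card_insert_of_notMem ha, pow_succ', mul_assoc, ih hJB]
    have hmem : ∀ y, y - w a ∈ Bx B φ c ξ T J ↔ (φ y ∈ T ∧ (∀ i ∈ B, i ≠ a → lpos (c i y) (c i ξ))
        ∧ (∀ i ∈ J, ¬ lpos (c i y - 1) (c i ξ)) ∧ lpos (c a y - 1) (c a ξ)) := by
      intro y
      have h1 : ∀ i ∈ B, i ≠ a → c i (y - w a) = c i y := by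
        intro i hi hia
        rw [map_sub, hF.cw i hi a haB, if_neg hia, sub_zero]
      have h2 : c a (y - w a) = c a y - 1 := by
        rw [map_sub, hF.cw a haB a haB, if_pos rfl]
      simp only [Bx, Sb, Set.mem_ofPred_eq, map_sub φ, hF.φw a haB, sub_zero]
      constructor
      · rintro ⟨⟨k1, k2⟩, k3⟩
        refine ⟨k1, fun i hi hia => ?_, fun i hi => ?_, ?_⟩
        · rw [← h1 i hi hia]; exact k2 i hi
        · rw [← h1 i (hJB hi) (by rintro rfl; exact ha hi)]; exact k3 i hi
        · rw [← h2]; exact k2 a haB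
      · rintro ⟨k1, k2, k3, k4⟩
        refine ⟨⟨k1, fun i hi => ?_⟩, fun i hi => ?_⟩
        · by_cases hia : i = a
          · subst hia; rw [h2]; exact k4
          · rw [h1 i hi hia]; exact k2 i hi hia
        · rw [h1 i (hJB hi) (by rintro rfl; exact ha hi)]; exact k3 i hi
    have hsubS : Bx B φ c ξ T J ⊆ Sb B φ c ξ T := fun y hy => hy.1
    rw [gfs_peel (hS.mono hsubS) (hw a) (hq a) (fun y hy => hpos y (hsubS hy))]
    · congr 1
      ext y
      simp only [Set.mem_ofPred_eq, hmem]
      simp only [Bx, Sb, Set.mem_ofPred_eq]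
      constructor
      · rintro ⟨⟨⟨k1, k2⟩, k3⟩, k4⟩
        refine ⟨⟨k1, k2⟩, fun i hi => ?_⟩
        rcases Finset.mem_insert.1 hi with rfl | hi
        · intro hc
          exact k4 ⟨k1, fun j hj _ => k2 j hj, k3, hc⟩
        · exact k3 i hi
      · rintro ⟨⟨k1, k2⟩, k3⟩
        refine ⟨⟨⟨k1, k2⟩, fun i hi => k3 i (Finset.mem_insert_of_mem hi)⟩, fun hc => ?_⟩
        exact k3 a (Finset.mem_insert_self _ _) hc.2.2.2
    · intro y hy
      rw [hmem] at hy
      obtain ⟨k1, k2, k3, k4⟩ := hy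
      refine ⟨⟨k1, fun i hi => ?_⟩, k3⟩
      by_cases hia : i = a
      · subst hia; exact lpos_of_sub_one k4
      · exact k2 i hi hia

/-- reversal of boxes -/
lemma Bx_rev {p : E} {w : ι → E} {B : Finset ι}
    {φ : E →ₗ[ℝ] ℝ} {c : ι → E →ₗ[ℝ] ℝ} (hF : Fr p w B φ c) {ξ : E} (hξ : ∀ i ∈ B, c i ξ ≠ 0)
    {T T' : Set ℝ} (hT : ∀ t, t ∈ T → 1 - t ∈ T') {y : E} (hy : y ∈ Bx B φ c ξ T B) :
    p + ∑ i ∈ B, w i - y ∈ Bx B φ c (-ξ) T' B := by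
  obtain ⟨⟨k1, k2⟩, k3⟩ := hy
  have h1 : φ (p + ∑ i ∈ B, w i - y) = 1 - φ y := by
    rw [map_sub, map_add, hF.φp, map_sum, Finset.sum_eq_zero hF.φw, add_zero]
  have h2 : ∀ i ∈ B, c i (p + ∑ i ∈ B, w i - y) = 1 - c i y := by
    intro i hi
    rw [map_sub, map_add, hF.cp i hi, map_sum, Finset.sum_congr rfl (fun j hj => hF.cw i hi j hj),
      Finset.sum_ite_eq, if_pos hi, zero_add]
  refine ⟨⟨?_, fun i hi => ?_⟩, fun i hi => ?_⟩
  · rw [h1]; exact hT _ k1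
  · rw [h2 i hi, map_neg, show 1 - c i y = -(c i y - 1) by ring, lpos_neg (hξ i hi)]
    exact k3 i hi
  · rw [h2 i hi, map_neg, show 1 - c i y - 1 = -(c i y) by ring, lpos_neg (hξ i hi), not_not]
    exact k2 i hi

lemma gfs_Bx_rev {L : AddSubgroup E} {dg : E →ₗ[ℝ] ℝ} {p : E} {w : ι → E} {B : Finset ι}
    {φ : E →ₗ[ℝ] ℝ} {c : ι → E →ₗ[ℝ] ℝ} (hF : Fr p w B φ c) {ξ : E} (hξ : ∀ i ∈ B, c i ξ ≠ 0)
    {T T' : Set ℝ} (hT : ∀ t, t ∈ T ↔ 1 - t ∈ T') {M : ℕ} (hpL : p ∈ L) (hwL : ∀ i, w i ∈ L)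
    (hM : dg (p + ∑ i ∈ B, w i) = M) {k : ℕ} (hk : k ≤ M) :
    PowerSeries.coeff k (gfs L dg (Bx B φ c (-ξ) T' B))
      = PowerSeries.coeff (M - k) (gfs L dg (Bx B φ c ξ T B)) := by
  have hL : p + ∑ i ∈ B, w i ∈ L := L.add_mem hpL (L.sum_mem fun i _ => hwL i)
  simp only [gfs, PowerSeries.coeff_mk]
  congr 1
  apply Set.ncard_congr (fun y _ => p + ∑ i ∈ B, w i - y)
  · rintro y ⟨h1, h2, h3⟩
    refine ⟨?_, L.sub_mem hL h2, ?_⟩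
    · have := Bx_rev (T' := T) hF (ξ := -ξ) (by intro i hi; simpa using hξ i hi) (fun t ht => ?_) h1
      · rwa [neg_neg] at this
      · rw [hT]; simpa using ht
    · rw [map_sub, hM, h3, Nat.cast_sub hk]
  · intro a b _ _ hab
    exact sub_right_injective hab
  · rintro y ⟨h1, h2, h3⟩
    refine ⟨p + ∑ i ∈ B, w i - y, ⟨Bx_rev hF hξ (fun t ht => (hT t).1 ht) h1, L.sub_mem hL h2, ?_⟩, by simp⟩
    rw [map_sub, hM, h3, Nat.cast_sub hk]; ring

lemma gfs_Bx_big {L : AddSubgroup E} {dg : E →ₗ[ℝ] ℝ} {p : E} {w : ι → E} {B : Finset ι}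
    {φ : E →ₗ[ℝ] ℝ} {c : ι → E →ₗ[ℝ] ℝ} (hF : Fr p w B φ c) {ξ : E} (hξ : ∀ i ∈ B, c i ξ ≠ 0)
    {T T' : Set ℝ} (hT : ∀ t, t ∈ T → 1 - t ∈ T') {M : ℕ}
    (hM : dg (p + ∑ i ∈ B, w i) = M) (hpos : ∀ y ∈ Sb B φ c (-ξ) T', 0 ≤ dg y) {k : ℕ} (hk : M < k) :
    PowerSeries.coeff k (gfs L dg (Bx B φ c ξ T B)) = 0 := by
  simp only [gfs, PowerSeries.coeff_mk]
  rw [Nat.cast_eq_zero]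
  refine (congrArg Set.ncard ?_).trans (Set.ncard_empty E)
  rw [Set.eq_empty_iff_forall_notMem]
  rintro y ⟨h1, h2, h3⟩
  have := hpos _ (Bx_rev hF hξ hT h1).1
  rw [map_sub, hM, h3] at this
  have : (k : ℝ) ≤ M := by linarith
  have : k ≤ M := by exact_mod_cast this
  omega

end Counting


section Fan
open Filter Topology
variable {E : Type*} [NormedAddCommGroup E] [NormedSpace ℝ E] [FiniteDimensional ℝ E]
variable {ι : Type*} [DecidableEq ι] [Fintype ι]

lemma lpos_eventually (a b : ℝ) (hb : b ≠ 0) :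
    ∀ᶠ ε : ℝ in 𝓝[>] 0, (0 < a + ε * b ↔ lpos a b) := by
  have hc : Tendsto (fun ε : ℝ => a + ε * b) (𝓝[>] 0) (𝓝 a) := by
    have : Tendsto (fun ε : ℝ => a + ε * b) (𝓝 0) (𝓝 (a + 0 * b)) := by
      apply Continuous.tendsto; fun_prop
    rw [zero_mul, add_zero] at this
    exact this.mono_left nhdsWithin_le_nhds
  rcases lt_trichotomy a 0 with h | h | h
  · filter_upwards [hc.eventually (gt_mem_nhds h)] with ε hε
    unfold lpos; constructor
    · intro; linarith
    · rintro (h' | ⟨h', _⟩) <;> linarith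
  · subst h
    filter_upwards [self_mem_nhdsWithin] with ε hε
    have hε : 0 < ε := hε
    unfold lpos
    simp [hε]
  · filter_upwards [hc.eventually (lt_mem_nhds h)] with ε hε
    unfold lpos; constructor
    · intro; left; exact h
    · intro; exact hε

lemma exists_avoid {F : Type*} [AddCommGroup F] [Module ℝ F] {κ : Type*} (s : Finset κ)
    (U : κ → Submodule ℝ F) : ∃ g : F, ∀ k ∈ s, U k ≠ ⊤ → g ∉ U k := by
  classical
  have := Subspace.biUnion_ne_univ_of_top_notMem (k := ℝ) (E := F)
    (s := (s.image U).filter (fun u => u ≠ ⊤)) (by simp)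
  rw [Set.ne_univ_iff_exists_notMem] at this
  obtain ⟨g, hg⟩ := this
  refine ⟨g, fun k hk hU hgU => hg ?_⟩
  simp only [Set.mem_iUnion]
  exact ⟨U k, by simp only [Finset.mem_filter, Finset.mem_image]; exact ⟨⟨k, hk, rfl⟩, hU⟩, hgU⟩

lemma exists_Fr (p : E) (hp : p ≠ 0) (w : ι → E) (I : Finset ι)
    (hI : Submodule.span ℝ (insert p (w '' I)) = ⊤) :
    ∃ B ⊆ I, ∃ φ c, Fr p w B φ c := by
  classical
  let v : Option ι → E := fun o => o.elim p w
  have h0 : LinearIndepOn ℝ v {none} := by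
    rw [linearIndepOn_singleton_iff]; exact hp
  obtain ⟨b, hbt, hsb, hsp, hli⟩ := exists_linearIndepOn_extension h0
    (t := insert none (some '' (I : Set ι))) (by simp)
  have hnone : none ∈ b := hsb rfl
  let B := I.filter (fun i => some i ∈ b)
  let f : Option B → E := fun o => v (o.map Subtype.val)
  have hfli : LinearIndependent ℝ f := by
    let m : Option B → b := fun o => ⟨o.map Subtype.val, by
      cases o with
      | none => exact hnone
      | some i => exact (Finset.mem_filter.1 i.2).2⟩
    have hm : Function.Injective m := by
      intro x y hxy
      exact Option.map_injective Subtype.val_injective (congrArg Subtype.val hxy)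
    exact LinearIndependent.comp hli m hm
  have hfsp : ⊤ ≤ Submodule.span ℝ (Set.range f) := by
    rw [← hI, Submodule.span_le]
    have h1 : v '' b ⊆ Set.range f := by
      rintro _ ⟨o, ho, rfl⟩
      cases o with
      | none => exact ⟨none, rfl⟩
      | some i =>
        have : i ∈ I := by
          have := hbt ho
          simpa using this
        exact ⟨some ⟨i, Finset.mem_filter.2 ⟨this, ho⟩⟩, rfl⟩
    have h2 : insert p (w '' (I : Set ι)) ⊆ v '' (insert none (some '' (I : Set ι))) := by
      rintro y (rfl | ⟨i, hi, rfl⟩)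
      · exact ⟨none, by simp, rfl⟩
      · exact ⟨some i, by simpa using hi, rfl⟩
    exact h2.trans (hsp.trans (Submodule.span_mono h1))
  let bs := Module.Basis.mk hfli hfsp
  have hbs : ∀ o, bs o = f o := fun o => Module.Basis.mk_apply hfli hfsp o
  refine ⟨B, Finset.filter_subset _ _, bs.coord none,
    fun i => if h : i ∈ B then bs.coord (some ⟨i, h⟩) else 0, ?_⟩
  have hcoord : ∀ o o', bs.coord o (f o') = if o' = o then 1 else 0 := by
    intro o o'
    rw [← hbs, Module.Basis.coord_apply, Module.Basis.repr_self, Finsupp.single_apply]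
  constructor
  · intro y
    conv_lhs => rw [← bs.sum_repr y]
    rw [Fintype.sum_option, hbs none]
    congr 1
    rw [← Finset.sum_coe_sort B]
    apply Finset.sum_congr rfl
    intro i _
    rw [dif_pos i.2, hbs]
    rfl
  · exact (hcoord none none).trans (by simp)
  · intro i hi
    exact (hcoord none (some ⟨i, hi⟩)).trans (by simp)
  · intro i hi
    rw [dif_pos hi]
    exact (hcoord (some ⟨i, hi⟩) none).trans (by simp)
  · intro i hi j hj
    rw [dif_pos hi]
    refine (hcoord (some ⟨i, hi⟩) (some ⟨j, hj⟩)).trans ?_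
    simp [eq_comm]
  · rw [Module.finrank_eq_card_basis bs]
    simp

/-- generic vector -/
def Gen (p : E) (w : ι → E) (y : E) : Prop :=
  ∀ I : Finset ι, Submodule.span ℝ (insert p (w '' I)) ≠ ⊤ →
    y ∉ Submodule.span ℝ (insert p (w '' I))

lemma Gen.coord_ne {p : E} {w : ι → E} {y : E} (hy : Gen p w y) {B : Finset ι}
    {φ : E →ₗ[ℝ] ℝ} {c : ι → E →ₗ[ℝ] ℝ} (hF : Fr p w B φ c) {i : ι} (hi : i ∈ B) : c i y ≠ 0 := by
  intro h0
  have hker : Submodule.span ℝ (insert p (w '' (B.erase i : Finset ι))) ≤ LinearMap.ker (c i) := by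
    rw [Submodule.span_le]
    rintro z (rfl | ⟨j, hj, rfl⟩)
    · exact hF.cp i hi
    · have hj' := Finset.mem_erase.1 hj
      have := hF.cw i hi j hj'.2
      rw [if_neg (Ne.symm hj'.1)] at this
      exact this
  apply hy (B.erase i)
  · intro htop
    rw [htop] at hker
    have : w i ∈ LinearMap.ker (c i) := hker trivial
    rw [LinearMap.mem_ker, hF.cw i hi i hi] at this
    simp at this
  · rw [hF.expand y, ← Finset.add_sum_erase B _ hi, h0, zero_smul, zero_add]
    apply Submodule.add_mem
    · exact Submodule.smul_mem _ _ (Submodule.subset_span (Set.mem_insert _ _))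
    · apply Submodule.sum_mem
      intro j hj
      exact Submodule.smul_mem _ _ (Submodule.subset_span (Set.mem_insert_of_mem _ ⟨j, hj, rfl⟩))

lemma exists_Gen (p : E) (w : ι → E) : ∃ ξ, Gen p w ξ := by
  obtain ⟨g, hg⟩ := exists_avoid (Finset.univ : Finset (Finset ι))
    (fun I => Submodule.span ℝ (insert p (w '' I)))
  exact ⟨g, fun I => hg I (Finset.mem_univ _)⟩

lemma Gen.neg {p : E} {w : ι → E} {y : E} (hy : Gen p w y) : Gen p w (-y) := by
  intro I hI h
  exact hy I hI (by simpa using Submodule.neg_mem _ h)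

lemma Gen.eventually {p : E} {w : ι → E} {ξ : E} (hξ : Gen p w ξ) (y : E) :
    ∀ᶠ ε : ℝ in 𝓝[>] 0, Gen p w (y + ε • ξ) := by
  unfold Gen
  rw [eventually_all]
  intro I
  by_cases hI : Submodule.span ℝ (insert p (w '' (I : Set ι))) = ⊤
  · exact Eventually.of_forall fun ε h => absurd hI h
  set U := Submodule.span ℝ (insert p (w '' (I : Set ι))) with hU
  by_cases hyU : y ∈ U
  · filter_upwards [self_mem_nhdsWithin] with ε hε _ hmem
    have hε : 0 < ε := hε
    have h1 : ε • ξ ∈ U := by simpa using U.sub_mem hmem hyU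
    have h2 := U.smul_mem ε⁻¹ h1
    rw [smul_smul, inv_mul_cancel₀ hε.ne', one_smul] at h2
    exact hξ I hI h2
  · have hcl : IsClosed (U : Set E) := U.closed_of_finiteDimensional
    have ht : Tendsto (fun ε : ℝ => y + ε • ξ) (𝓝[>] 0) (𝓝 y) := by
      have : Tendsto (fun ε : ℝ => y + ε • ξ) (𝓝 0) (𝓝 (y + (0:ℝ) • ξ)) := by
        apply Continuous.tendsto; fun_prop
      rw [zero_smul, add_zero] at this
      exact this.mono_left nhdsWithin_le_nhds
    filter_upwards [ht.eventually (hcl.isOpen_compl.mem_nhds hyU)] with ε hε _ hmem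
    exact hε hmem

end Fan


section LP
open Filter Topology
variable {E : Type*} [NormedAddCommGroup E] [NormedSpace ℝ E] [FiniteDimensional ℝ E]
variable {ι : Type*} [DecidableEq ι] [Fintype ι]

/-- perturbed height functional -/
def lamf (B : Finset ι) (φ : E →ₗ[ℝ] ℝ) (c : ι → E →ₗ[ℝ] ℝ) (h : ι → ℝ) (y : E) : ℝ :=
  φ y - ∑ i ∈ B, c i y * h i

lemma Fr.expand' {p : E} {w : ι → E} {B : Finset ι} {φ : E →ₗ[ℝ] ℝ} {c : ι → E →ₗ[ℝ] ℝ}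
    (hF : Fr p w B φ c) (h : ι → ℝ) (y : E) :
    y = lamf B φ c h y • p + ∑ i ∈ B, c i y • (w i + h i • p) := by
  conv_lhs => rw [hF.expand y]
  simp only [lamf, smul_add, Finset.sum_add_distrib, sub_smul, Finset.sum_smul, smul_smul]
  abel

lemma lamf_add (B : Finset ι) (φ : E →ₗ[ℝ] ℝ) (c : ι → E →ₗ[ℝ] ℝ) (h : ι → ℝ) (x y : E) :
    lamf B φ c h (x + y) = lamf B φ c h x + lamf B φ c h y := by
  simp only [lamf, map_add, add_mul, Finset.sum_add_distrib]; ring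

lemma lamf_smul (B : Finset ι) (φ : E →ₗ[ℝ] ℝ) (c : ι → E →ₗ[ℝ] ℝ) (h : ι → ℝ) (t : ℝ) (y : E) :
    lamf B φ c h (t • y) = t * lamf B φ c h y := by
  simp only [lamf, map_smul, smul_eq_mul, mul_assoc, ← Finset.mul_sum]; ring

lemma lamf_sum (B : Finset ι) (φ : E →ₗ[ℝ] ℝ) (c : ι → E →ₗ[ℝ] ℝ) (h : ι → ℝ) (s : Finset ι)
    (f : ι → E) :
    lamf B φ c h (∑ i ∈ s, f i) = ∑ i ∈ s, lamf B φ c h (f i) := by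
  induction s using Finset.induction_on with
  | empty => simp [lamf]
  | insert a s ha ih => rw [Finset.sum_insert ha, Finset.sum_insert ha, lamf_add, ih]

lemma lamf_p {p : E} {w : ι → E} {B : Finset ι} {φ : E →ₗ[ℝ] ℝ} {c : ι → E →ₗ[ℝ] ℝ}
    (hF : Fr p w B φ c) (h : ι → ℝ) : lamf B φ c h p = 1 := by
  rw [lamf, hF.φp, Finset.sum_eq_zero, sub_zero]
  intro i hi
  rw [hF.cp i hi, zero_mul]

lemma lamf_w {p : E} {w : ι → E} {B : Finset ι} {φ : E →ₗ[ℝ] ℝ} {c : ι → E →ₗ[ℝ] ℝ}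
    (hF : Fr p w B φ c) (h : ι → ℝ) {i : ι} (hi : i ∈ B) :
    lamf B φ c h (w i + h i • p) = 0 := by
  rw [lamf_add, lamf_smul, lamf_p hF, lamf, hF.φw i hi]
  have : ∑ j ∈ B, c j (w i) * h j = ∑ j ∈ B, (if j = i then h j else 0) := by
    apply Finset.sum_congr rfl
    intro j hj
    rw [hF.cw j hj i hi]; split_ifs <;> simp
  rw [this, Finset.sum_ite_eq', if_pos hi]; ring

lemma fan_unique {p : E} {w : ι → E} {B : Finset ι} {φ : E →ₗ[ℝ] ℝ} {c : ι → E →ₗ[ℝ] ℝ}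
    (hF : Fr p w B φ c) {B' : Finset ι} {φ' : E →ₗ[ℝ] ℝ} {c' : ι → E →ₗ[ℝ] ℝ}
    (hF' : Fr p w B' φ' c') (h : ι → ℝ)
    (hB : ∀ j, 0 ≤ lamf B φ c h (w j + h j • p)) (hB' : ∀ j, 0 ≤ lamf B' φ' c' h (w j + h j • p))
    (hne : ∀ j, j ∉ B → lamf B φ c h (w j + h j • p) ≠ 0)
    (hne' : ∀ j, j ∉ B' → lamf B' φ' c' h (w j + h j • p) ≠ 0)
    (y : E) (hy : ∀ i ∈ B, 0 < c i y) (hy' : ∀ i ∈ B', 0 < c' i y) : B = B' := by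
  have e1 : lamf B φ c h y = lamf B' φ' c' h y + ∑ i ∈ B', c' i y * lamf B φ c h (w i + h i • p) := by
    conv_lhs => rw [hF'.expand' h y]
    rw [lamf_add, lamf_smul, lamf_p hF, lamf_sum, mul_one]
    simp only [lamf_smul]
  have e2 : lamf B' φ' c' h y = lamf B φ c h y + ∑ i ∈ B, c i y * lamf B' φ' c' h (w i + h i • p) := by
    conv_lhs => rw [hF.expand' h y]
    rw [lamf_add, lamf_smul, lamf_p hF', lamf_sum, mul_one]
    simp only [lamf_smul]
  have n1 : ∀ i ∈ B', 0 ≤ c' i y * lamf B φ c h (w i + h i • p) :=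
    fun i hi => mul_nonneg (hy' i hi).le (hB i)
  have n2 : ∀ i ∈ B, 0 ≤ c i y * lamf B' φ' c' h (w i + h i • p) :=
    fun i hi => mul_nonneg (hy i hi).le (hB' i)
  have s1 := Finset.sum_nonneg n1
  have s2 := Finset.sum_nonneg n2
  have z1 := (Finset.sum_eq_zero_iff_of_nonneg n1).1 (by linarith)
  have z2 := (Finset.sum_eq_zero_iff_of_nonneg n2).1 (by linarith)
  apply Finset.Subset.antisymm
  · intro i hi
    by_contra hc
    rcases mul_eq_zero.1 (z2 i hi) with h0 | h0
    · exact (hy i hi).ne' h0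
    · exact hne' i hc h0
  · intro i hi
    by_contra hc
    rcases mul_eq_zero.1 (z1 i hi) with h0 | h0
    · exact (hy' i hi).ne' h0
    · exact hne i hc h0

lemma lp_opt (p : E) (u : ι → E) (dg : E →ₗ[ℝ] ℝ) (hp : 0 < dg p) (hu : ∀ i, 0 < dg (u i)) (y : E)
    (hne : ∃ (t : ℝ) (a : ι → ℝ), (∀ i, 0 ≤ a i) ∧ y = t • p + ∑ i, a i • u i) :
    ∃ (t : ℝ) (a : ι → ℝ), (∀ i, 0 ≤ a i) ∧ y = t • p + ∑ i, a i • u i ∧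
      ∀ (t' : ℝ) (a' : ι → ℝ), (∀ i, 0 ≤ a' i) → y = t' • p + ∑ i, a' i • u i → t' ≤ t := by
  obtain ⟨t0, a0, ha0, hy0⟩ := hne
  let K : Set (ℝ × (ι → ℝ)) := {x | t0 ≤ x.1 ∧ (∀ i, 0 ≤ x.2 i) ∧ y = x.1 • p + ∑ i, x.2 i • u i}
  have hcl : IsClosed K := by
    have hKe : K = {x : ℝ × (ι → ℝ) | t0 ≤ x.1} ∩ ((⋂ i, {x : ℝ × (ι → ℝ) | 0 ≤ x.2 i}) ∩
        {x : ℝ × (ι → ℝ) | y = x.1 • p + ∑ i, x.2 i • u i}) := by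
      ext x; simp [K]
    rw [hKe]
    exact (isClosed_le (by fun_prop) (by fun_prop)).inter
      ((isClosed_iInter fun i => isClosed_le (by fun_prop) (by fun_prop)).inter
        (isClosed_eq (by fun_prop) (by fun_prop)))
  have hsub : K ⊆ Set.Icc ((t0, fun _ => 0) : ℝ × (ι → ℝ))
      (dg y / dg p, fun i => (dg y - t0 * dg p) / dg (u i)) := by
    rintro ⟨t, a⟩ ⟨h1, h2, h3⟩
    simp only at h1 h2 h3
    have e : dg y = t * dg p + ∑ i, a i * dg (u i) := by
      rw [h3]; simp
    have nn : ∀ i ∈ Finset.univ, 0 ≤ a i * dg (u i) := fun i _ => mul_nonneg (h2 i) (hu i).le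
    have hs := Finset.sum_nonneg nn
    refine ⟨⟨h1, h2⟩, ⟨?_, fun i => ?_⟩⟩
    · rw [le_div_iff₀ hp]; linarith
    · simp only
      rw [le_div_iff₀ (hu i)]
      have := Finset.single_le_sum nn (Finset.mem_univ i)
      have := mul_le_mul_of_nonneg_right h1 hp.le
      linarith
  have hK : IsCompact K := isCompact_Icc.of_isClosed_subset hcl hsub
  obtain ⟨⟨t, a⟩, ⟨h1, h2, h3⟩, hmax⟩ := hK.exists_isMaxOn ⟨(t0, a0), le_rfl, ha0, hy0⟩
    (f := fun x => x.1) (by fun_prop)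
  refine ⟨t, a, h2, h3, fun t' a' ha' hy' => ?_⟩
  by_cases h : t0 ≤ t'
  · exact hmax (a := (t', a')) ⟨h, ha', hy'⟩
  · exact (not_le.1 h).le.trans h1

lemma nonneg_eventually (a b : ℝ) (ha : 0 ≤ a) (hb : a = 0 → 0 ≤ b) :
    ∀ᶠ ε : ℝ in 𝓝[>] 0, 0 ≤ a + ε * b := by
  rcases ha.eq_or_lt with h | h
  · filter_upwards [self_mem_nhdsWithin] with ε hε
    have hε : 0 < ε := hε
    have := hb h.symm
    rw [← h]; positivity
  · have hc : Tendsto (fun ε : ℝ => a + ε * b) (𝓝[>] 0) (𝓝 a) := by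
      have : Tendsto (fun ε : ℝ => a + ε * b) (𝓝 0) (𝓝 (a + 0 * b)) := by
        apply Continuous.tendsto; fun_prop
      rw [zero_mul, add_zero] at this
      exact this.mono_left nhdsWithin_le_nhds
    filter_upwards [hc.eventually (lt_mem_nhds h)] with ε hε
    exact hε.le

/-- pivoting -/
lemma lp_pivot {p : E} {w : ι → E} {B : Finset ι} {φ : E →ₗ[ℝ] ℝ} {c : ι → E →ₗ[ℝ] ℝ}
    (hF : Fr p w B φ c) (h : ι → ℝ) (y : E) (t : ℝ) (a : ι → ℝ) (ha : ∀ i, 0 ≤ a i)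
    (hy : y = t • p + ∑ i, a i • (w i + h i • p))
    (hopt : ∀ (t' : ℝ) (a' : ι → ℝ), (∀ i, 0 ≤ a' i) →
      y = t' • p + ∑ i, a' i • (w i + h i • p) → t' ≤ t)
    (hB : ∀ i ∈ B, 0 < a i) (j : ι) (s : ℝ) (hs : a j = 0 → 0 ≤ s) :
    0 ≤ s * lamf B φ c h (w j + h j • p) := by
  let z := w j + h j • p
  let D : ι → ℝ := fun k => s * ((if k = j then 1 else 0) - (if k ∈ B then c k z else 0))
  have hev : ∀ᶠ ε : ℝ in 𝓝[>] 0, ∀ k, 0 ≤ a k + ε * D k := by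
    rw [eventually_all]
    intro k
    apply nonneg_eventually _ _ (ha k)
    intro hk
    have hkB : k ∉ B := fun hc => (hB k hc).ne' hk
    simp only [D, if_neg hkB, sub_zero]
    split_ifs with hkj
    · subst hkj; simpa using hs hk
    · simp
  obtain ⟨ε, hε, hε0⟩ := (hev.and self_mem_nhdsWithin).exists
  have hε0 : 0 < ε := hε0
  have hsum : ∑ k, D k • (w k + h k • p) = (s * lamf B φ c h z) • p := by
    have hz := hF.expand' h z
    simp only [D, mul_smul, ← Finset.smul_sum, sub_smul, Finset.sum_sub_distrib, ite_smul, one_smul, zero_smul,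
      Finset.sum_ite_eq', Finset.mem_univ, if_true, Finset.sum_ite_mem, Finset.univ_inter]
    congr 1
    rw [sub_eq_iff_eq_add]; exact hz
  have := hopt (t - ε * (s * lamf B φ c h z)) (fun k => a k + ε * D k) hε (by
    simp only [add_smul, Finset.sum_add_distrib, mul_smul ε, ← Finset.smul_sum, sub_smul]
    rw [hsum, hy]
    abel)
  have h2 : 0 ≤ ε * (s * lamf B φ c h z) := by linarith
  exact nonneg_of_mul_nonneg_right h2 hε0

lemma fan_exists {p : E} {w : ι → E} {𝔅 : Finset (Finset ι)} {φ : Finset ι → E →ₗ[ℝ] ℝ}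
    {c : Finset ι → ι → E →ₗ[ℝ] ℝ} (hF : ∀ B ∈ 𝔅, Fr p w B (φ B) (c B))
    (hex : ∀ I : Finset ι, Submodule.span ℝ (insert p (w '' I)) = ⊤ → ∃ B ∈ 𝔅, B ⊆ I)
    (h : ι → ℝ) (dg : E →ₗ[ℝ] ℝ) (hp : 0 < dg p) (hu : ∀ i, 0 < dg (w i + h i • p))
    (hne : ∀ B ∈ 𝔅, ∀ j, j ∉ B → lamf B (φ B) (c B) h (w j + h j • p) ≠ 0)
    (y : E) (hy : Gen p w y)
    (hfeas : ∃ (t : ℝ) (a : ι → ℝ), (∀ i, 0 ≤ a i) ∧ y = t • p + ∑ i, a i • (w i + h i • p)) :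
    ∃ B ∈ 𝔅, (∀ j, 0 ≤ lamf B (φ B) (c B) h (w j + h j • p)) ∧ ∀ i ∈ B, 0 < c B i y := by
  obtain ⟨t, a, ha, hya, hopt⟩ := lp_opt p _ dg hp hu y hfeas
  let I : Finset ι := Finset.univ.filter (fun i => 0 < a i)
  have hsum : ∀ J : Finset ι, I ⊆ J → ∑ i, a i • (w i + h i • p) = ∑ i ∈ J, a i • (w i + h i • p) := by
    intro J hJ
    symm
    apply Finset.sum_subset (Finset.subset_univ _)
    intro i _ hi
    have : a i = 0 := by
      by_contra hc
      exact hi (hJ (Finset.mem_filter.2 ⟨Finset.mem_univ _, lt_of_le_of_ne (ha i) (Ne.symm hc)⟩))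
    rw [this, zero_smul]
  have hspan : Submodule.span ℝ (insert p (w '' (I : Set ι))) = ⊤ := by
    by_contra hc
    apply hy I hc
    have hpm : p ∈ Submodule.span ℝ (insert p (w '' (I : Set ι))) :=
      Submodule.subset_span (Set.mem_insert _ _)
    rw [hya, hsum I subset_rfl]
    apply Submodule.add_mem _ (Submodule.smul_mem _ _ hpm)
    apply Submodule.sum_mem
    intro i hi
    apply Submodule.smul_mem
    apply Submodule.add_mem _ _ (Submodule.smul_mem _ _ hpm)
    exact Submodule.subset_span (Set.mem_insert_of_mem _ ⟨i, hi, rfl⟩)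
  obtain ⟨B, hB, hBI⟩ := hex I hspan
  have hBpos : ∀ i ∈ B, 0 < a i := fun i hi => (Finset.mem_filter.1 (hBI hi)).2
  have piv := lp_pivot (hF B hB) h y t a ha hya hopt hBpos
  have hnn : ∀ j, 0 ≤ lamf B (φ B) (c B) h (w j + h j • p) := by
    intro j
    simpa using piv j 1 (fun _ => zero_le_one)
  have hIB : I ⊆ B := by
    intro j hj
    by_contra hc
    have := piv j (-1) (fun h0 => absurd h0 (Finset.mem_filter.1 hj).2.ne')
    exact hne B hB j hc (le_antisymm (by linarith) (hnn j))
  refine ⟨B, hB, hnn, fun i hi => ?_⟩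
  have : c B i y = a i := by
    rw [hya, hsum B hIB, map_add, map_smul, (hF B hB).cp i hi, map_sum]
    have : ∀ j ∈ B, c B i (a j • (w j + h j • p)) = if i = j then a j else 0 := by
      intro j hj
      rw [map_smul, map_add, map_smul, (hF B hB).cp i hi, (hF B hB).cw i hi j hj]
      split_ifs <;> simp
    rw [Finset.sum_congr rfl this, Finset.sum_ite_eq, if_pos hi]; simp
  rw [this]; exact hBpos i hi

lemma exists_heights {p : E} {w : ι → E} {𝔅 : Finset (Finset ι)} {φ : Finset ι → E →ₗ[ℝ] ℝ}
    {c : Finset ι → ι → E →ₗ[ℝ] ℝ} (hF : ∀ B ∈ 𝔅, Fr p w B (φ B) (c B))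
    (dg : E →ₗ[ℝ] ℝ) (hw : ∀ i, 0 < dg (w i)) :
    ∃ h : ι → ℝ, (∀ i, 0 < dg (w i + h i • p)) ∧
      ∀ B ∈ 𝔅, ∀ j, j ∉ B → lamf B (φ B) (c B) h (w j + h j • p) ≠ 0 ∧
        (φ B (w j) < 0 → lamf B (φ B) (c B) h (w j + h j • p) < 0) := by
  let f : Finset ι × ι → ((ι → ℝ) →ₗ[ℝ] ℝ) := fun x =>
    LinearMap.proj x.2 - ∑ i ∈ x.1, c x.1 i (w x.2) • LinearMap.proj i
  obtain ⟨g, hg⟩ := exists_avoid (Finset.univ : Finset (Finset ι × ι)) (fun x => LinearMap.ker (f x))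
  have hf : ∀ B j (g : ι → ℝ), f (B, j) g = g j - ∑ i ∈ B, c B i (w j) * g i := by
    intro B j g
    simp [f]
  have hne : ∀ B j, j ∉ B → f (B, j) g ≠ 0 := by
    intro B j hj
    apply hg (B, j) (Finset.mem_univ _)
    intro htop
    have : (Pi.single j 1 : ι → ℝ) ∈ LinearMap.ker (f (B, j)) := by
      rw [htop]; trivial
    rw [LinearMap.mem_ker, hf, Finset.sum_eq_zero] at this
    · simp at this
    · intro i hi
      rw [Pi.single_eq_of_ne (by rintro rfl; exact hj hi), mul_zero]
  have hlam : ∀ B ∈ 𝔅, ∀ j, ∀ ε : ℝ, lamf B (φ B) (c B) (fun i => ε * g i) (w j + (ε * g j) • p)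
      = φ B (w j) + ε * f (B, j) g := by
    intro B hB j ε
    rw [lamf_add, lamf_smul, lamf_p (hF B hB), hf, lamf, mul_sub, Finset.mul_sum]
    have : ∀ i ∈ B, c B i (w j) * (ε * g i) = ε * (c B i (w j) * g i) := fun i _ => by ring
    rw [Finset.sum_congr rfl this]
    ring
  have ev1 : ∀ᶠ ε : ℝ in 𝓝[>] 0, ∀ i, 0 < dg (w i + (ε * g i) • p) := by
    rw [eventually_all]
    intro i
    have hc : Tendsto (fun ε : ℝ => dg (w i) + (ε * g i) * dg p) (𝓝[>] 0) (𝓝 (dg (w i))) := by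
      have : Tendsto (fun ε : ℝ => dg (w i) + (ε * g i) * dg p) (𝓝 0) (𝓝 (dg (w i) + (0 * g i) * dg p)) := by
        apply Continuous.tendsto; fun_prop
      rw [zero_mul, zero_mul, add_zero] at this
      exact this.mono_left nhdsWithin_le_nhds
    filter_upwards [hc.eventually (lt_mem_nhds (hw i))] with ε hε
    simpa using hε
  have ev2 : ∀ᶠ ε : ℝ in 𝓝[>] 0, ∀ B j, j ∉ B → (φ B (w j) + ε * f (B, j) g ≠ 0 ∧
      (φ B (w j) < 0 → φ B (w j) + ε * f (B, j) g < 0)) := by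
    rw [eventually_all]; intro B
    rw [eventually_all]; intro j
    by_cases hj : j ∈ B
    · exact Eventually.of_forall fun ε h => absurd hj h
    filter_upwards [lpos_eventually (φ B (w j)) _ (hne B j hj),
      lpos_eventually (-φ B (w j)) _ (neg_ne_zero.2 (hne B j hj))] with ε h1 h2 _
    rw [lpos_neg (hne B j hj), ← h1] at h2
    constructor
    · intro h0
      rw [h0] at h1
      have : 0 < -φ B (w j) + ε * -f (B, j) g := h2.2 (by rw [h0]; exact lt_irrefl 0)
      linarith
    · intro hneg
      have : ¬ (0 < φ B (w j) + ε * f (B, j) g) := by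
        rw [h1]; rintro (h' | h') <;> linarith [h']
      have := h2.2 this
      linarith
  obtain ⟨ε, h1, h2⟩ := (ev1.and ev2).exists
  refine ⟨fun i => ε * g i, h1, fun B hB j hj => ?_⟩
  simp only
  rw [hlam B hB j ε]
  exact h2 B j hj

/-- The complete fan. -/
theorem fan_main (p : E) (w : ι → E) (dg : E →ₗ[ℝ] ℝ) (hp : 0 < dg p) (hw : ∀ i, 0 < dg (w i))
    (hcone : ∀ y : E, ∃ (t : ℝ) (a : ι → ℝ), (∀ i, 0 ≤ a i) ∧ y = t • p + ∑ i, a i • w i) :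
    ∃ (𝒯 : Finset (Finset ι)) (φ : Finset ι → E →ₗ[ℝ] ℝ) (c : Finset ι → ι → E →ₗ[ℝ] ℝ),
      (∀ B ∈ 𝒯, Fr p w B (φ B) (c B)) ∧ (∀ B ∈ 𝒯, ∀ j, 0 ≤ φ B (w j)) ∧
      ∀ ξ, Gen p w ξ → ∀ y, ∃ B ∈ 𝒯, (∀ i ∈ B, lpos (c B i y) (c B i ξ)) ∧
        ∀ B' ∈ 𝒯, (∀ i ∈ B', lpos (c B' i y) (c B' i ξ)) → B = B' := by
  classical
  let 𝔅 : Finset (Finset ι) := Finset.univ.filter (fun B => ∃ φ c, Fr p w B φ c)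
  have h𝔅 : ∀ B : Finset ι, ∃ (φ : E →ₗ[ℝ] ℝ) (c : ι → E →ₗ[ℝ] ℝ), B ∈ 𝔅 → Fr p w B φ c := by
    intro B
    by_cases hB : B ∈ 𝔅
    · obtain ⟨φ, c, h⟩ := (Finset.mem_filter.1 hB).2
      exact ⟨φ, c, fun _ => h⟩
    · exact ⟨0, 0, fun h => absurd h hB⟩
  choose φ c hF using h𝔅
  have hex : ∀ I : Finset ι, Submodule.span ℝ (insert p (w '' I)) = ⊤ → ∃ B ∈ 𝔅, B ⊆ I := by
    intro I hI
    obtain ⟨B, hBI, hB⟩ := exists_Fr p (by rintro rfl; simp at hp) w I hI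
    exact ⟨B, Finset.mem_filter.2 ⟨Finset.mem_univ _, hB⟩, hBI⟩
  obtain ⟨h, hu, hh⟩ := exists_heights hF dg hw
  let 𝒯 := 𝔅.filter (fun B => ∀ j, 0 ≤ lamf B (φ B) (c B) h (w j + h j • p))
  have hT : ∀ B ∈ 𝒯, B ∈ 𝔅 := fun B hB => (Finset.mem_filter.1 hB).1
  refine ⟨𝒯, φ, c, fun B hB => hF B (hT B hB), fun B hB j => ?_, fun ξ hξ y => ?_⟩
  · by_cases hj : j ∈ B
    · rw [(hF B (hT B hB)).φw j hj]
    · by_contra hc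
      exact absurd ((hh B (hT B hB) j hj).2 (not_le.1 hc)) (not_lt.2 ((Finset.mem_filter.1 hB).2 j))
  · have ev : ∀ᶠ ε : ℝ in 𝓝[>] 0, ∀ B, ∀ i, B ∈ 𝒯 → i ∈ B →
        (0 < c B i y + ε * c B i ξ ↔ lpos (c B i y) (c B i ξ)) := by
      rw [eventually_all]; intro B
      rw [eventually_all]; intro i
      by_cases hB : B ∈ 𝒯
      · by_cases hi : i ∈ B
        · filter_upwards [lpos_eventually (c B i y) (c B i ξ) (hξ.coord_ne (hF B (hT B hB)) hi)] with ε hε _ _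
          exact hε
        · exact Eventually.of_forall fun ε _ h => absurd h hi
      · exact Eventually.of_forall fun ε h => absurd h hB
    obtain ⟨ε, hε, hgen⟩ := (ev.and (hξ.eventually y)).exists
    have hconv : ∀ B ∈ 𝒯, (∀ i ∈ B, lpos (c B i y) (c B i ξ)) ↔ ∀ i ∈ B, 0 < c B i (y + ε • ξ) := by
      intro B hB
      apply forall₂_congr
      intro i hi
      rw [← hε B i hB hi]; simp
    obtain ⟨B, hB, hB1, hB2⟩ := fan_exists hF hex h dg hp hu (fun B hB j hj => (hh B hB j hj).1)
      (y + ε • ξ) hgen (by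
        obtain ⟨t, a, ha, hta⟩ := hcone (y + ε • ξ)
        refine ⟨t - ∑ i, a i * h i, a, ha, ?_⟩
        rw [hta]
        simp only [smul_add, Finset.sum_add_distrib, sub_smul, Finset.sum_smul, smul_smul]
        abel)
    have hBT : B ∈ 𝒯 := Finset.mem_filter.2 ⟨hB, hB1⟩
    refine ⟨B, hBT, (hconv B hBT).2 hB2, fun B' hB' hy' => ?_⟩
    exact fan_unique (hF B hB) (hF B' (hT B' hB')) h hB1 (Finset.mem_filter.1 hB').2
      (fun j hj => (hh B hB j hj).1) (fun j hj => (hh B' (hT B' hB') j hj).1) (y + ε • ξ) hB2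
      ((hconv B' hB').1 hy')
end LP


section Main
variable {E : Type*} [NormedAddCommGroup E] [NormedSpace ℝ E] [FiniteDimensional ℝ E]
variable {ι : Type*} [DecidableEq ι] [Fintype ι]

/-- cone generated by `w` -/
def coneS (w : ι → E) : Set E := {y | ∃ a : ι → ℝ, (∀ i, 0 ≤ a i) ∧ y = ∑ i, a i • w i}

/-- points from which one can move a bit in direction `-p` -/
def coneI (w : ι → E) (p : E) : Set E := {y | ∃ ε : ℝ, 0 < ε ∧ y - ε • p ∈ coneS w}

lemma coneS_add {w : ι → E} {x y : E} (hx : x ∈ coneS w) (hy : y ∈ coneS w) : x + y ∈ coneS w := by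
  obtain ⟨a, ha, rfl⟩ := hx
  obtain ⟨b, hb, rfl⟩ := hy
  exact ⟨fun i => a i + b i, fun i => add_nonneg (ha i) (hb i), by
    simp [add_smul, Finset.sum_add_distrib]⟩

lemma coneS_smul {w : ι → E} {x : E} (hx : x ∈ coneS w) {t : ℝ} (ht : 0 ≤ t) : t • x ∈ coneS w := by
  obtain ⟨a, ha, rfl⟩ := hx
  exact ⟨fun i => t * a i, fun i => mul_nonneg ht (ha i), by
    simp [mul_smul, Finset.smul_sum]⟩

lemma coneS_zero {w : ι → E} : (0 : E) ∈ coneS w := ⟨0, by simp, by simp⟩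

lemma coneS_w {w : ι → E} (i : ι) : w i ∈ coneS w :=
  ⟨Pi.single i 1, fun j => by by_cases h : j = i <;> simp [Pi.single_apply, h], by
    simp [Pi.single_apply]⟩

lemma coneS_sum {w : ι → E} (s : Finset ι) (a : ι → ℝ) (ha : ∀ i ∈ s, 0 ≤ a i) :
    ∑ i ∈ s, a i • w i ∈ coneS w := by
  induction s using Finset.induction_on with
  | empty => simpa using coneS_zero
  | insert b s hb ih =>
    rw [Finset.sum_insert hb]
    exact coneS_add (coneS_smul (coneS_w b) (ha b (Finset.mem_insert_self _ _)))
      (ih fun i hi => ha i (Finset.mem_insert_of_mem hi))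

lemma lpos.nonneg {a b : ℝ} (h : lpos a b) : 0 ≤ a := by
  rcases h with h | h
  · exact h.le
  · exact h.1.ge

theorem count_main (L : AddSubgroup E) (dg : E →ₗ[ℝ] ℝ) (p : E) (w : ι → E) (q d l : ℕ)
    (hq : 0 < q) (hl : 0 < l) (hpL : p ∈ L) (hwL : ∀ i, w i ∈ L) (hdp : dg p = l)
    (hdw : ∀ i, dg (w i) = q) (hpC : p ∈ coneS w) (hfr : Module.finrank ℝ E = d + 1)
    (hfin : FinSl L dg (coneS w))
    (hcone : ∀ y : E, ∃ t : ℝ, y - t • p ∈ coneS w) :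
    (∀ n, 0 ≤ PowerSeries.coeff n ((1 - PowerSeries.X ^ q) ^ d *
      (gfs L dg (coneS w) - gfs L dg (coneI w p)))) ∧
    (∀ n, 0 ≤ PowerSeries.coeff n ((1 - PowerSeries.X ^ q) ^ d *
      (gfs L dg (coneI w p) - PowerSeries.X ^ l * gfs L dg (coneS w)))) ∧
    ∃ A A' : PowerSeries ℤ,
      (1 - PowerSeries.X ^ l) * (1 - PowerSeries.X ^ q) ^ d * gfs L dg (coneS w) = A ∧
      (1 - PowerSeries.X ^ l) * (1 - PowerSeries.X ^ q) ^ d * gfs L dg (coneI w p) = A' ∧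
      (∀ k, l + q * d < k → PowerSeries.coeff k A = 0) ∧
      (∀ k, l + q * d < k → PowerSeries.coeff k A' = 0) ∧
      (∀ k, k ≤ l + q * d → PowerSeries.coeff k A' = PowerSeries.coeff (l + q * d - k) A) := by
  obtain ⟨𝒯, φ, c, hF, hφ, huniq⟩ := fan_main p w dg (by rw [hdp]; exact_mod_cast hl)
    (fun i => by rw [hdw]; exact_mod_cast hq) (fun y => by
      obtain ⟨t, a, ha, h⟩ := hcone y
      exact ⟨t, a, ha, by rw [← h]; abel⟩)
  obtain ⟨ξ, hξ⟩ := exists_Gen p w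
  have hpos : ∀ y ∈ coneS w, 0 ≤ dg y := by
    rintro y ⟨a, ha, rfl⟩
    rw [map_sum]
    apply Finset.sum_nonneg
    intro i _
    rw [map_smul, hdw, smul_eq_mul]
    exact mul_nonneg (ha i) (Nat.cast_nonneg _)
  have hIC : coneI w p ⊆ coneS w := by
    rintro y ⟨ε, hε, hy⟩
    have := coneS_add hy (coneS_smul hpC hε.le)
    simpa using this
  -- membership criteria
  have mS : ∀ B ∈ 𝒯, ∀ y, (∀ i ∈ B, 0 ≤ c B i y) → (y ∈ coneS w ↔ 0 ≤ φ B y) := by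
    intro B hB y hy
    constructor
    · rintro ⟨a, ha, rfl⟩
      rw [map_sum]
      apply Finset.sum_nonneg
      intro i _
      rw [map_smul, smul_eq_mul]
      exact mul_nonneg (ha i) (hφ B hB i)
    · intro h
      rw [(hF B hB).expand y]
      exact coneS_add (coneS_smul hpC h) (coneS_sum _ _ hy)
  have mSt : ∀ B ∈ 𝒯, ∀ y, (∀ i ∈ B, 0 ≤ c B i y) → ∀ t : ℝ, (y - t • p ∈ coneS w ↔ t ≤ φ B y) := by
    intro B hB y hy t
    rw [mS B hB (y - t • p)]
    · rw [map_sub, map_smul, (hF B hB).φp, smul_eq_mul, mul_one, sub_nonneg]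
    · intro i hi
      rw [map_sub, map_smul, (hF B hB).cp i hi, smul_zero, sub_zero]
      exact hy i hi
  have mI : ∀ B ∈ 𝒯, ∀ y, (∀ i ∈ B, 0 ≤ c B i y) → (y ∈ coneI w p ↔ 0 < φ B y) := by
    intro B hB y hy
    constructor
    · rintro ⟨ε, hε, h⟩
      rw [mSt B hB y hy] at h
      linarith
    · intro h
      exact ⟨φ B y, h, (mSt B hB y hy _).2 le_rfl⟩
  have mIt : ∀ B ∈ 𝒯, ∀ y, (∀ i ∈ B, 0 ≤ c B i y) → (y - p ∈ coneI w p ↔ 1 < φ B y) := by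
    intro B hB y hy
    rw [mI B hB (y - p)]
    · rw [map_sub, (hF B hB).φp, sub_pos]
    · intro i hi
      rw [map_sub, (hF B hB).cp i hi, sub_zero]
      exact hy i hi
  have mS1 : ∀ B ∈ 𝒯, ∀ y, (∀ i ∈ B, 0 ≤ c B i y) → (y - p ∈ coneS w ↔ 1 ≤ φ B y) := by
    intro B hB y hy
    have := mSt B hB y hy 1
    rwa [one_smul] at this
  have hSbC : ∀ B ∈ 𝒯, ∀ ξ, ∀ T : Set ℝ, (∀ t ∈ T, 0 ≤ t) → Sb B (φ B) (c B) ξ T ⊆ coneS w := by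
    intro B hB ξ T hT y hy
    exact (mS B hB y (fun i hi => (hy.2 i hi).nonneg)).2 (hT _ hy.1)
  have hcard : ∀ B ∈ 𝒯, B.card = d := by
    intro B hB
    have := (hF B hB).card
    omega
  have decomp : ∀ ξ, Gen p w ξ → ∀ (S : Set E) (T : Set ℝ), (∀ t ∈ T, 0 ≤ t) →
      (∀ B ∈ 𝒯, ∀ y, (∀ i ∈ B, 0 ≤ c B i y) → (y ∈ S ↔ φ B y ∈ T)) →
      (1 - PowerSeries.X ^ q) ^ d * gfs L dg S
        = ∑ B ∈ 𝒯, gfs L dg (Bx B (φ B) (c B) ξ T B) := by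
    intro ξ hξ S T hT hST
    have hS : S = ⋃ B ∈ 𝒯, Sb B (φ B) (c B) ξ T := by
      ext y
      simp only [Set.mem_iUnion]
      constructor
      · intro hy
        obtain ⟨B, hB, h1, _⟩ := huniq ξ hξ y
        exact ⟨B, hB, (hST B hB y (fun i hi => (h1 i hi).nonneg)).1 hy, h1⟩
      · rintro ⟨B, hB, h1, h2⟩
        exact (hST B hB y (fun i hi => (h2 i hi).nonneg)).2 h1
    rw [hS, gfs_biUnion, Finset.mul_sum]
    · apply Finset.sum_congr rfl
      intro B hB
      have := gfs_Sb (hF B hB) (ξ := ξ) (T := T) hwL hdw (hfin.mono (hSbC B hB ξ T hT))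
        (fun y hy => hpos y (hSbC B hB ξ T hT hy)) B subset_rfl
      rw [hcard B hB] at this
      exact this
    · intro B hB
      exact hfin.mono (hSbC B hB ξ T hT)
    · intro B hB B' hB' hne
      rw [Set.disjoint_left]
      intro y hy hy'
      obtain ⟨B0, _, _, h0⟩ := huniq ξ hξ y
      exact hne ((h0 B hB hy.2).symm.trans (h0 B' hB' hy'.2))
  have nn : ∀ ξ (T : Set ℝ) n, 0 ≤ PowerSeries.coeff n (∑ B ∈ 𝒯, gfs L dg (Bx B (φ B) (c B) ξ T B)) := by
    intro ξ T n
    rw [map_sum]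
    exact Finset.sum_nonneg fun B _ => gfs_nonneg _ _ _ _
  refine ⟨fun n => ?_, fun n => ?_, ?_⟩
  · have e : gfs L dg (coneS w) - gfs L dg (coneI w p) = gfs L dg {y | y ∈ coneS w ∧ y ∉ coneI w p} := by
      rw [sub_eq_iff_eq_add, ← gfs_union (hfin.mono fun y hy => hy.1) (hfin.mono hIC)]
      · congr 1
        ext y
        simp only [Set.mem_union, Set.mem_ofPred_eq]
        have := @hIC y
        tauto
      · rw [Set.disjoint_left]
        rintro y ⟨_, hy⟩ hy'; exact hy hy'
    rw [e, decomp ξ hξ _ {0} (by simp)]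
    · exact nn _ _ _
    · intro B hB y hy
      simp only [Set.mem_ofPred_eq, mS B hB y hy, mI B hB y hy, not_lt, Set.mem_singleton_iff]
      constructor
      · rintro ⟨h1, h2⟩; linarith
      · intro h; rw [h]; simp
  · have e : gfs L dg (coneI w p) - PowerSeries.X ^ l * gfs L dg (coneS w)
        = gfs L dg {y | y ∈ coneI w p ∧ y - p ∉ coneS w} := by
      have hsub : {y | y - p ∈ coneS w} ⊆ coneI w p := fun y hy => ⟨1, one_pos, by rw [one_smul]; exact hy⟩
      rw [sub_eq_iff_eq_add, ← gfs_shift hpL hdp hpos,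
        ← gfs_union (hfin.mono fun y hy => hIC hy.1) (hfin.mono (hsub.trans hIC))]
      · congr 1
        ext y
        simp only [Set.mem_union, Set.mem_ofPred_eq]
        have := @hsub y
        simp only [Set.mem_ofPred_eq] at this
        tauto
      · rw [Set.disjoint_left]
        rintro y ⟨_, hy⟩ hy'; exact hy hy'
    rw [e, decomp ξ hξ _ (Set.Ioo 0 1) (fun t ht => ht.1.le)]
    · exact nn _ _ _
    · intro B hB y hy
      simp only [Set.mem_ofPred_eq, mS1 B hB y hy, mI B hB y hy, not_le, Set.mem_Ioo]
  · have hM : ∀ B ∈ 𝒯, dg (p + ∑ i ∈ B, w i) = ((l + q * d : ℕ) : ℝ) := by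
      intro B hB
      rw [map_add, map_sum, Finset.sum_congr rfl (fun i _ => hdw i), hdp, Finset.sum_const, hcard B hB]
      simp [mul_comm]
    have hneg : ∀ B ∈ 𝒯, ∀ i ∈ B, c B i ξ ≠ 0 := fun B hB i hi => hξ.coord_ne (hF B hB) hi
    refine ⟨_, _, rfl, rfl, ?_⟩
    have hA : (1 - PowerSeries.X ^ l) * (1 - PowerSeries.X ^ q) ^ d * gfs L dg (coneS w)
        = ∑ B ∈ 𝒯, gfs L dg (Bx B (φ B) (c B) ξ (Set.Ico 0 1) B) := by
      rw [mul_comm (1 - PowerSeries.X ^ l), mul_assoc, gfs_peel hfin hpL hdp hpos,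
        decomp ξ hξ _ (Set.Ico 0 1) (fun t ht => ht.1)]
      · intro B hB y hy
        simp only [Set.mem_ofPred_eq, mS1 B hB y hy, mS B hB y hy, not_le, Set.mem_Ico]
      · intro y hy
        simpa using coneS_add hy hpC
    have hA' : (1 - PowerSeries.X ^ l) * (1 - PowerSeries.X ^ q) ^ d * gfs L dg (coneI w p)
        = ∑ B ∈ 𝒯, gfs L dg (Bx B (φ B) (c B) (-ξ) (Set.Ioc 0 1) B) := by
      rw [mul_comm (1 - PowerSeries.X ^ l), mul_assoc, gfs_peel (hfin.mono hIC) hpL hdp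
        (fun y hy => hpos y (hIC hy)), decomp (-ξ) hξ.neg _ (Set.Ioc 0 1) (fun t ht => ht.1.le)]
      · intro B hB y hy
        simp only [Set.mem_ofPred_eq, mIt B hB y hy, mI B hB y hy, not_lt, Set.mem_Ioc]
      · intro y hy
        exact ⟨1, one_pos, by rw [one_smul]; exact hIC hy⟩
    rw [hA, hA']
    simp only [map_sum]
    refine ⟨fun k hk => ?_, fun k hk => ?_, fun k hk => ?_⟩
    · apply Finset.sum_eq_zero
      intro B hB
      exact gfs_Bx_big (hF B hB) (hneg B hB) (T' := Set.Ioc 0 1)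
        (fun t ht => ⟨by linarith [ht.2], by linarith [ht.1]⟩) (hM B hB)
        (fun y hy => hpos y (hSbC B hB _ _ (fun t ht => ht.1.le) hy)) hk
    · apply Finset.sum_eq_zero
      intro B hB
      exact gfs_Bx_big (hF B hB) (ξ := -ξ) (by intro i hi; simpa using hneg B hB i hi) (T' := Set.Ico 0 1)
        (fun t ht => ⟨by linarith [ht.2], by linarith [ht.1]⟩) (hM B hB)
        (fun y hy => hpos y (hSbC B hB _ _ (fun t ht => ht.1) hy)) hk
    · apply Finset.sum_congr rfl
      intro B hB
      exact gfs_Bx_rev (hF B hB) (hneg B hB) (fun t => by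
        simp only [Set.mem_Ico, Set.mem_Ioc]; constructor <;> rintro ⟨h1, h2⟩ <;> constructor <;> linarith)
        hpL hwL (hM B hB) hk
end Main


/-- the lattice `ℤ^d × ℤ` -/
def latL (d : ℕ) : AddSubgroup ((Fin d → ℝ) × ℝ) where
  carrier := {y | IsLatticePt y.1 ∧ ∃ a : ℤ, y.2 = a}
  add_mem' := by
    rintro x y ⟨hx, a, ha⟩ ⟨hy, b, hb⟩
    refine ⟨fun i => ?_, a + b, by simp [ha, hb]⟩
    obtain ⟨m, hm⟩ := hx i
    obtain ⟨k, hk⟩ := hy i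
    exact ⟨m + k, by simp [hm, hk]⟩
  zero_mem' := ⟨fun i => ⟨0, by simp⟩, 0, by simp⟩
  neg_mem' := by
    rintro x ⟨hx, a, ha⟩
    refine ⟨fun i => ?_, -a, by simp [ha]⟩
    obtain ⟨m, hm⟩ := hx i
    exact ⟨-m, by simp [hm]⟩

lemma mem_latL {d : ℕ} (x : Fin d → ℝ) (t : ℝ) :
    (x, t) ∈ latL d ↔ IsLatticePt x ∧ ∃ a : ℤ, t = a := Iff.rfl

lemma latticePt_finite {d : ℕ} (S : Set (Fin d → ℝ)) (hS : Bornology.IsBounded S) :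
    {x | x ∈ S ∧ IsLatticePt x}.Finite := by
  obtain ⟨R, hR⟩ := hS.exists_norm_le
  obtain ⟨N, hN⟩ := exists_nat_ge R
  apply ((Set.finite_Icc (fun _ : Fin d => -(N : ℤ)) (fun _ => (N : ℤ))).image
    (fun z : Fin d → ℤ => fun i => (z i : ℝ))).subset
  rintro x ⟨hx, hl⟩
  choose z hz using hl
  have hb : ∀ i, |(z i : ℝ)| ≤ N := fun i => by
    have := norm_le_pi_norm x i
    rw [hz i, Real.norm_eq_abs] at this
    exact this.trans ((hR x hx).trans hN)
  refine ⟨z, ⟨fun i => ?_, fun i => ?_⟩, ?_⟩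
  · have := (abs_le.1 (hb i)).1
    exact_mod_cast this
  · have := (abs_le.1 (hb i)).2
    exact_mod_cast this
  · funext i
    exact (hz i).symm

/-- generators of the cone over `P` -/
def wV {d : ℕ} (V : Finset (Fin d → ℝ)) (q : ℕ) (v : V) : (Fin d → ℝ) × ℝ := (v.1, (q : ℝ))

lemma mem_coneV {d q : ℕ} {P : Set (Fin d → ℝ)} {V : Finset (Fin d → ℝ)} (hq : 0 < q)
    (hV : (q : ℝ) • P = convexHull ℝ (V : Set (Fin d → ℝ))) (x : Fin d → ℝ) (t : ℝ) :
    (x, t) ∈ coneS (wV V q) ↔ (t = 0 ∧ x = 0) ∨ (0 < t ∧ t⁻¹ • x ∈ P) := by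
  have hq' : (0 : ℝ) < q := by exact_mod_cast hq
  constructor
  · rintro ⟨a, ha, h⟩
    have hx : x = ∑ v, a v • v.1 := by
      have := congrArg Prod.fst h
      rw [Prod.fst_sum] at this
      exact this
    have ht : t = (∑ v, a v) * q := by
      have := congrArg Prod.snd h
      rw [Prod.snd_sum] at this
      rw [Finset.sum_mul]
      exact this
    rcases (Finset.sum_nonneg fun v _ => ha v).eq_or_lt' with h0 | h0
    · left
      refine ⟨by rw [ht, h0, zero_mul], ?_⟩
      have h1 := (Finset.sum_eq_zero_iff_of_nonneg (fun v _ => ha v)).1 h0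
      rw [hx]
      exact Finset.sum_eq_zero fun v hv => by rw [h1 v hv, zero_smul]
    · right
      refine ⟨by rw [ht]; positivity, ?_⟩
      have hm : (∑ v, a v)⁻¹ • x ∈ (q : ℝ) • P := by
        rw [hV, hx, Finset.smul_sum]
        simp_rw [smul_smul]
        apply (convex_convexHull ℝ _).sum_mem
        · intro v _
          exact mul_nonneg (inv_nonneg.2 h0.le) (ha v)
        · rw [← Finset.mul_sum, inv_mul_cancel₀ h0.ne']
        · intro v _
          exact subset_convexHull ℝ _ v.2
      obtain ⟨y, hy, hyx⟩ := hm
      have : t⁻¹ • x = y := by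
        rw [ht, mul_inv_rev, ← smul_smul, ← hyx]
        simp only [smul_smul]
        rw [inv_mul_cancel₀ hq'.ne', one_smul]
      rw [this]; exact hy
  · rintro (⟨rfl, rfl⟩ | ⟨ht, hx⟩)
    · exact coneS_zero
    · have hm : (q : ℝ) • (t⁻¹ • x) ∈ convexHull ℝ (V : Set (Fin d → ℝ)) := by
        rw [← hV]; exact Set.smul_mem_smul_set hx
      rw [Finset.mem_convexHull'] at hm
      obtain ⟨b, hb, hb1, hbx⟩ := hm
      refine ⟨fun v => t / q * b v.1, fun v => mul_nonneg (by positivity) (hb _ v.2), ?_⟩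
      apply Prod.ext
      · rw [Prod.fst_sum]
        change x = ∑ v : V, (t / q * b v.1) • v.1
        simp_rw [mul_smul]
        rw [← Finset.smul_sum, Finset.sum_coe_sort V (fun v => b v • v), hbx, smul_smul, smul_smul]
        have : t / q * q * t⁻¹ = 1 := by field_simp
        rw [this, one_smul]
      · rw [Prod.snd_sum]
        change t = ∑ v : V, (t / q * b v.1) * q
        rw [← Finset.sum_mul, ← Finset.mul_sum, Finset.sum_coe_sort V (fun v => b v), hb1]
        field_simp

lemma exists_int_dilate {d : ℕ} {P : Set (Fin d → ℝ)} (hfull : (interior P).Nonempty) :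
    ∃ k : ℕ, 0 < k ∧ ∃ x, IsLatticePt x ∧ (k : ℝ)⁻¹ • x ∈ interior P := by
  obtain ⟨c, hc⟩ := hfull
  obtain ⟨r, hr, hb⟩ := Metric.isOpen_iff.1 isOpen_interior c hc
  obtain ⟨n, hn⟩ := exists_nat_gt (1 / r)
  have hn0 : (0 : ℝ) < n := lt_trans (by positivity) hn
  refine ⟨n, by exact_mod_cast hn0, fun i => (round (n * c i) : ℝ), fun i => ⟨_, rfl⟩, hb ?_⟩
  rw [Metric.mem_ball, dist_pi_lt_iff hr]
  intro i
  have h1 : |n * c i - round (n * c i)| ≤ 1 / 2 := abs_sub_round _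
  have h2 : 1 < n * r := by
    rw [div_lt_iff₀ hr] at hn; exact hn
  simp only [Pi.smul_apply, smul_eq_mul]
  rw [dist_comm, Real.dist_eq]
  have h3 : c i - (n : ℝ)⁻¹ * round (n * c i) = (n : ℝ)⁻¹ * (n * c i - round (n * c i)) := by
    field_simp
  rw [h3, abs_mul, abs_of_pos (inv_pos.2 hn0), inv_mul_lt_iff₀ hn0]
  linarith

lemma coneI_int {d q : ℕ} {P : Set (Fin d → ℝ)} {V : Finset (Fin d → ℝ)} (hq : 0 < q)
    (hV : (q : ℝ) • P = convexHull ℝ (V : Set (Fin d → ℝ))) (hconv : Convex ℝ P)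
    (xp : Fin d → ℝ) (l : ℕ) (hl : 0 < l) (hxp : (l : ℝ)⁻¹ • xp ∈ interior P)
    (x : Fin d → ℝ) (k : ℝ) (h : (x, k) ∈ coneI (wV V q) (xp, (l : ℝ))) :
    0 < k ∧ k⁻¹ • x ∈ interior P := by
  have hl' : (0 : ℝ) < l := by exact_mod_cast hl
  obtain ⟨ε, hε, h⟩ := h
  have h' : (x - ε • xp, k - ε * l) ∈ coneS (wV V q) := h
  rw [mem_coneV hq hV] at h'
  have he : 0 < ε * l := mul_pos hε hl'
  rcases h' with ⟨h1, h2⟩ | ⟨h1, h2⟩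
  · have hk : k = ε * l := by linarith
    have hx : x = ε • xp := sub_eq_zero.1 h2
    refine ⟨hk ▸ he, ?_⟩
    rw [hk, hx, smul_smul]
    have : (ε * l)⁻¹ * ε = (l : ℝ)⁻¹ := by field_simp
    rw [this]; exact hxp
  · have hk : 0 < k := by linarith
    refine ⟨hk, ?_⟩
    have := hconv.combo_self_interior_mem_interior h2 hxp (a := (k - ε * l) / k)
      (b := ε * l / k) (by positivity) (by positivity) (by field_simp; ring)
    convert this using 1
    rw [smul_smul, smul_smul]
    have e1 : (k - ε * l) / k * (k - ε * l)⁻¹ = k⁻¹ := by field_simp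
    have e2 : ε * l / k * (l : ℝ)⁻¹ = k⁻¹ * ε := by field_simp
    rw [e1, e2, smul_sub, smul_smul]
    abel

lemma cone_absorb {d q : ℕ} {P : Set (Fin d → ℝ)} {V : Finset (Fin d → ℝ)} (hq : 0 < q)
    (hV : (q : ℝ) • P = convexHull ℝ (V : Set (Fin d → ℝ)))
    (xp : Fin d → ℝ) (l : ℕ) (hl : 0 < l) (hxp : (l : ℝ)⁻¹ • xp ∈ interior P)
    (y : (Fin d → ℝ) × ℝ) : ∃ t : ℝ, y - t • (xp, (l : ℝ)) ∈ coneS (wV V q) := by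
  have hl' : (0 : ℝ) < l := by exact_mod_cast hl
  obtain ⟨x, s⟩ := y
  have c1 : ContinuousAt (fun ε : ℝ => (l : ℝ) + ε * s) 0 := by fun_prop
  have c2 : ContinuousAt (fun ε : ℝ => ((l : ℝ) + ε * s)⁻¹ • (xp + ε • x)) 0 := by
    refine ContinuousAt.smul (f := fun ε : ℝ => ((l : ℝ) + ε * s)⁻¹) (g := fun ε : ℝ => xp + ε • x) ?_ ?_
    · exact c1.inv₀ (by simpa using hl'.ne')
    · fun_prop
  have e1 : ∀ᶠ ε in nhds (0 : ℝ), 0 < (l : ℝ) + ε * s :=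
    c1.eventually (by simpa using lt_mem_nhds hl')
  have e2 : ∀ᶠ ε in nhds (0 : ℝ), ((l : ℝ) + ε * s)⁻¹ • (xp + ε • x) ∈ interior P :=
    c2.eventually (by simpa using isOpen_interior.mem_nhds hxp)
  have e3 := ((e1.and e2).filter_mono (nhdsWithin_le_nhds (s := Set.Ioi 0))).and
    (self_mem_nhdsWithin)
  obtain ⟨ε, ⟨h1, h2⟩, hε⟩ := e3.exists
  have hε : 0 < ε := hε
  have hm : (xp + ε • x, (l : ℝ) + ε * s) ∈ coneS (wV V q) :=
    (mem_coneV hq hV _ _).2 (Or.inr ⟨h1, interior_subset h2⟩)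
  refine ⟨-ε⁻¹, ?_⟩
  have := coneS_smul hm (inv_nonneg.2 hε.le)
  convert this using 1
  apply Prod.ext
  · change x - (-ε⁻¹) • xp = ε⁻¹ • (xp + ε • x)
    rw [smul_add, smul_smul, inv_mul_cancel₀ hε.ne', one_smul, neg_smul]
    abel
  · simp only [Prod.snd_sub, Prod.smul_snd, smul_eq_mul]
    field_simp
    ring

lemma slice_inj {d : ℕ} (S : Set ((Fin d → ℝ) × ℝ)) (n : ℕ) :
    {y | y ∈ S ∧ y ∈ latL d ∧ LinearMap.snd ℝ (Fin d → ℝ) ℝ y = (n : ℝ)}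
      = (fun x : Fin d → ℝ => (x, (n : ℝ))) '' {x | (x, (n : ℝ)) ∈ S ∧ IsLatticePt x} := by
  ext ⟨x, t⟩
  simp only [Set.mem_ofPred_eq, LinearMap.snd_apply, mem_latL, Set.mem_image, Prod.mk.injEq]
  constructor
  · rintro ⟨h1, ⟨h2, -⟩, rfl⟩
    exact ⟨x, ⟨h1, h2⟩, rfl, rfl⟩
  · rintro ⟨x', ⟨h1, h2⟩, rfl, rfl⟩
    exact ⟨h1, ⟨h2, n, by simp⟩, rfl⟩

lemma mem_slice {d : ℕ} (P : Set (Fin d → ℝ)) (n : ℝ) (hn : 0 < n) (x : Fin d → ℝ) :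
    x ∈ n • P ↔ n⁻¹ • x ∈ P := Set.mem_smul_set_iff_inv_smul_mem₀ hn.ne' P x

lemma hstar_aux {d q : ℕ} (P : Set (Fin d → ℝ))
    (hrat : IsRationalPolytope P) (hfull : IsFullDim P) (hq : IsDenominator P q)
    (hP : Polynomial ℤ) (hPdeg : hP.natDegree < q * (d + 1))
    (hPeq : (hP : PowerSeries ℤ) = (1 - PowerSeries.X ^ q) ^ (d + 1) * ehrSeries P) :
    (∀ j : ℕ, j ≤ (q * (d + 1) - 1) / 2 - 1 →
      ∑ i ∈ Finset.range (j + 1), hP.coeff (q * (d + 1) - 1 - i) ≤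
        ∑ i ∈ Finset.range (j + 2), hP.coeff i) ∧
    (∀ j : ℕ, j ≤ hP.natDegree →
      ∑ i ∈ Finset.range (j + 1), hP.coeff i ≤
        ∑ i ∈ Finset.range (j + 1), hP.coeff (hP.natDegree - i)) := by
  classical
  obtain ⟨hq0, ⟨V, hVL, hV⟩, -⟩ := hq
  have hPc : Convex ℝ P ∧ IsCompact P := by
    obtain ⟨W, -, rfl⟩ := hrat
    exact ⟨convex_convexHull ℝ _, W.finite_toSet.isCompact_convexHull (𝕜 := ℝ)⟩
  obtain ⟨hconv, hcomp⟩ := hPc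
  have hex := exists_int_dilate hfull
  set l := Nat.find hex with hldef
  obtain ⟨hl, xp, hxpL, hxp⟩ := Nat.find_spec hex
  rw [← hldef] at hl hxp
  have hl' : (0 : ℝ) < l := by exact_mod_cast hl
  have hpC : (xp, (l : ℝ)) ∈ coneS (wV V q) :=
    (mem_coneV hq0 hV _ _).2 (Or.inr ⟨hl', interior_subset hxp⟩)
  have hslice : ∀ n : ℕ, {x | (x, (n : ℝ)) ∈ coneS (wV V q) ∧ IsLatticePt x}
      = if n = 0 then {0} else {x ∈ (n : ℝ) • P | IsLatticePt x} := by
    intro n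
    split_ifs with hn
    · subst hn
      ext x
      simp only [Set.mem_ofPred_eq, Nat.cast_zero, mem_coneV hq0 hV, lt_irrefl, false_and, or_false,
        true_and, Set.mem_singleton_iff, and_iff_left_iff_imp]
      rintro rfl
      exact fun i => ⟨0, by simp⟩
    · have hn' : (0 : ℝ) < n := by exact_mod_cast Nat.pos_of_ne_zero hn
      ext x
      simp only [Set.mem_ofPred_eq, mem_coneV hq0 hV, hn'.ne', false_and, hn', true_and, false_or,
        mem_slice P _ hn']
  have hfin : FinSl (latL d) (LinearMap.snd ℝ (Fin d → ℝ) ℝ) (coneS (wV V q)) := by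
    intro n
    rw [slice_inj, hslice]
    apply Set.Finite.image
    split_ifs
    · exact Set.finite_singleton _
    · exact latticePt_finite _ (hcomp.smul (n : ℝ)).isBounded
  have hinj : ∀ n : ℕ, Function.Injective (fun x : Fin d → ℝ => (x, (n : ℝ))) :=
    fun n x y h => (Prod.mk.injEq _ _ _ _ ▸ h).1
  have hG : gfs (latL d) (LinearMap.snd ℝ (Fin d → ℝ) ℝ) (coneS (wV V q)) = ehrSeries P := by
    ext n
    rw [gfs, ehrSeries, PowerSeries.coeff_mk, PowerSeries.coeff_mk, slice_inj, hslice,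
      Set.ncard_image_of_injective _ (hinj n)]
    split_ifs
    · simp
    · rfl
  have hfr : Module.finrank ℝ ((Fin d → ℝ) × ℝ) = d + 1 := by simp
  obtain ⟨F1, F2, A, A', hA, hA', hz, hz', hr⟩ := count_main (latL d)
    (LinearMap.snd ℝ (Fin d → ℝ) ℝ) (xp, (l : ℝ)) (wV V q) q d l hq0 hl
    ⟨hxpL, l, by simp⟩ (fun v => ⟨hVL _ v.2, q, by simp [wV]⟩) rfl (fun v => rfl) hpC hfr hfin
    (cone_absorb hq0 hV xp l hl hxp)
  rw [hG] at F1 F2 hA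
  have hR := ps_reciprocity hP q d l hl hPdeg _ _ A A' hPeq hA hA' hz hz' hr
  refine final_ineq hP q d l hl hPdeg _ _ hPeq hR hq0 F1 F2 (by simp [ehrSeries]) ?_ ?_
  · intro k hk
    rw [gfs, PowerSeries.coeff_mk, slice_inj]
    have : {x | (x, (k : ℝ)) ∈ coneI (wV V q) (xp, (l : ℝ)) ∧ IsLatticePt x} = ∅ := by
      rw [Set.eq_empty_iff_forall_notMem]
      rintro x ⟨h1, h2⟩
      obtain ⟨h3, h4⟩ := coneI_int hq0 hV hconv xp l hl hxp x k h1
      exact Nat.find_min hex hk ⟨by exact_mod_cast h3, x, h2, h4⟩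
    rw [this]; simp
  · rw [gfs, PowerSeries.coeff_mk]
    have hfi : {y | y ∈ coneI (wV V q) (xp, (l : ℝ)) ∧ y ∈ latL d ∧
        LinearMap.snd ℝ (Fin d → ℝ) ℝ y = (l : ℝ)}.Finite := by
      apply (hfin l).subset
      rintro y ⟨⟨ε, hε, hy⟩, h2⟩
      refine ⟨?_, h2⟩
      have := coneS_add hy (coneS_smul hpC hε.le)
      simpa using this
    have hne : (xp, (l : ℝ)) ∈ {y | y ∈ coneI (wV V q) (xp, (l : ℝ)) ∧ y ∈ latL d ∧
        LinearMap.snd ℝ (Fin d → ℝ) ℝ y = (l : ℝ)} := by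
      refine ⟨⟨1, one_pos, ?_⟩, ⟨hxpL, l, by simp⟩, rfl⟩
      rw [one_smul, sub_self]; exact coneS_zero
    have := (Set.ncard_pos hfi).2 ⟨_, hne⟩
    exact_mod_cast this.ne'

/-- Hibi–Stanley-type inequalities for the coefficients of `h*_P`:
`h*_0 + ⋯ + h*_{j+1} ≥ h*_{q(d+1)−1} + ⋯ + h*_{q(d+1)−1−j}` for
`j = 0, …, ⌊(q(d+1)−1)/2⌋ − 1`, and
`h*_s + ⋯ + h*_{s−j} ≥ h*_0 + ⋯ + h*_j` for `j = 0, …, s` where `s = deg h*_P`. -/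
theorem hstar_inequalities {d q : ℕ} (P : Set (Fin d → ℝ))
    (hrat : IsRationalPolytope P) (hfull : IsFullDim P) (hq : IsDenominator P q)
    (hP : Polynomial ℤ) (hPdeg : hP.natDegree < q * (d + 1))
    (hPeq : (hP : PowerSeries ℤ) = (1 - PowerSeries.X ^ q) ^ (d + 1) * ehrSeries P) :
    (∀ j : ℕ, j ≤ (q * (d + 1) - 1) / 2 - 1 →
      ∑ i ∈ Finset.range (j + 1), hP.coeff (q * (d + 1) - 1 - i) ≤
        ∑ i ∈ Finset.range (j + 2), hP.coeff i) ∧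
    (∀ j : ℕ, j ≤ hP.natDegree →
      ∑ i ∈ Finset.range (j + 1), hP.coeff i ≤
        ∑ i ∈ Finset.range (j + 1), hP.coeff (hP.natDegree - i)) := by
  exact hstar_aux P hrat hfull hq hP hPdeg hPeq
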